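/- arXiv:2308.02946 — 2 statements merged into one kernel-verified Lean document; each statement's English description precedes it below -/
import Mathlib

section
/- There exists a constant η > 0 such that, with probability tending to 1 as n → ∞ over the random cost matrix C, every spanning tree T* of K_{A,B} with the following two properties — (a) T* contains a perfect matching M_π = {(a_i, b_{π(i)}) : i ∈ [n]} for some permutation π of [n] with π(i) ≠ i for all i, and (b) there exist real numbers (u_i)_{i∈[n]} and (v_j)_{j∈[n]} with u_i + v_j = C(i,j) for every edge (a_i, b_j) of T*, and u_i + v_j ≤ C(i,j) for every pair (i,j) with i ≠ j — is such that the contracted tree φ(T*) has at least ηn leaves. -/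
open MeasureTheory Finset

/-- The product measure on cost matrices: each entry independent uniform on `[0,1]`. -/
noncomputable def costMeasure (n : ℕ) : Measure (Fin n × Fin n → ℝ) :=
  Measure.pi fun _ => volume.restrict (Set.Icc 0 1)

/-- The cost of the permutation `π`: `∑ i, C (i, π i)`. -/
def permCost {n : ℕ} (C : Fin n × Fin n → ℝ) (π : Equiv.Perm (Fin n)) : ℝ :=
  ∑ i, C (i, π i)

/-- A permutation avoiding the diagonal. -/
def IsDerangement {n : ℕ} (π : Equiv.Perm (Fin n)) : Prop := ∀ i, π i ≠ i

/-- A cyclic permutation: a single cycle through all `n` points. -/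
def IsCyclicPerm {n : ℕ} (π : Equiv.Perm (Fin n)) : Prop := π.IsCycle ∧ ∀ i, π i ≠ i

/-- Optimal value of the assignment problem (diagonal forbidden). -/
noncomputable def ZAP (n : ℕ) (C : Fin n × Fin n → ℝ) : ℝ :=
  sInf {x | ∃ π : Equiv.Perm (Fin n), IsDerangement π ∧ x = permCost C π}

/-- Optimal value of the asymmetric TSP. -/
noncomputable def ZATSP (n : ℕ) (C : Fin n × Fin n → ℝ) : ℝ :=
  sInf {x | ∃ π : Equiv.Perm (Fin n), IsCyclicPerm π ∧ x = permCost C π}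

/-- The arcs in `F1` have in- and out-degree at most one and contain
no directed cycle of length `< n`. -/
def ValidArcs {n : ℕ} (F1 : Set (Fin n × Fin n)) : Prop :=
  (∀ e ∈ F1, ∀ e' ∈ F1, (e : Fin n × Fin n).1 = (e' : Fin n × Fin n).1 → e = e') ∧
  (∀ e ∈ F1, ∀ e' ∈ F1, (e : Fin n × Fin n).2 = (e' : Fin n × Fin n).2 → e = e') ∧
  (∀ k : ℕ, 0 < k → k < n → ∀ f : ZMod k → Fin n,
    Function.Injective f → ¬ (∀ t, (f t, f (t + 1)) ∈ F1))

/-- `(F0, F1)` is a constraint pair. -/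
def IsConstraint {n : ℕ} (F0 F1 : Finset (Fin n × Fin n)) : Prop :=
  Disjoint F0 F1 ∧ (∀ e ∈ F0 ∪ F1, (e : Fin n × Fin n).1 ≠ (e : Fin n × Fin n).2) ∧
    ValidArcs (F1 : Set (Fin n × Fin n))

/-- The inadmissible arcs: off-diagonal arcs not in `F1` whose addition to `F1`
violates the degree or short-cycle conditions. -/
def Fhat0 {n : ℕ} (F1 : Finset (Fin n × Fin n)) : Set (Fin n × Fin n) :=
  {e | e.1 ≠ e.2 ∧ e ∉ F1 ∧ ¬ ValidArcs (insert e (F1 : Set (Fin n × Fin n)))}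

/-- An arc not in `F0 ∪ F1 ∪ F̂0 ∪ D`. -/
def Admissible {n : ℕ} (F0 F1 : Finset (Fin n × Fin n)) (e : Fin n × Fin n) : Prop :=
  e.1 ≠ e.2 ∧ e ∉ F0 ∧ e ∉ F1 ∧ e ∉ Fhat0 F1

/-- `π` is feasible for `AP(F)`. -/
def FeasibleAP {n : ℕ} (F0 F1 : Finset (Fin n × Fin n)) (π : Equiv.Perm (Fin n)) : Prop :=
  (∀ i, π i ≠ i) ∧ (∀ e ∈ F1, π (e : Fin n × Fin n).1 = (e : Fin n × Fin n).2) ∧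
  (∀ i, (i, π i) ∉ F0 ∧ (i, π i) ∉ Fhat0 F1)

/-- Optimal value of the restricted assignment problem `AP(F)`. -/
noncomputable def ZAPF {n : ℕ} (C : Fin n × Fin n → ℝ) (F0 F1 : Finset (Fin n × Fin n)) : ℝ :=
  sInf {x | ∃ π : Equiv.Perm (Fin n), FeasibleAP F0 F1 π ∧ x = permCost C π}

/-- Condition (⋆): `|F1| ≤ n^{3ε/8}` and `|F0| ≤ n^{3ε/4}`. -/
def StarCond {n : ℕ} (ε : ℝ) (F0 F1 : Finset (Fin n × Fin n)) : Prop :=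
  (F1.card : ℝ) ≤ (n : ℝ) ^ (3 * ε / 8) ∧ (F0.card : ℝ) ≤ (n : ℝ) ^ (3 * ε / 4)

/-- `(a_i, b_j)` is an edge of `K_{A,B:F}`. -/
def EdgeKF {n : ℕ} (F0 F1 : Finset (Fin n × Fin n)) (i j : Fin n) : Prop :=
  i ≠ j ∧ (i, j) ∉ F0 ∧ (i, j) ∉ Fhat0 F1

/-- `b_j ∈ N_ζ(a_i)`: `(a_i,b_j)` is among the `ζ` cheapest edges of `K_{A,B:F}` at `a_i`. -/
def Nout {n : ℕ} (C : Fin n × Fin n → ℝ) (F0 F1 : Finset (Fin n × Fin n)) (ζ : ℕ)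
    (i : Fin n) : Set (Fin n) :=
  {j | EdgeKF F0 F1 i j ∧ {j' | EdgeKF F0 F1 i j' ∧ C (i, j') < C (i, j)}.ncard < ζ}

/-- `a_i ∈ N_ζ(b_j)`: `(a_i,b_j)` is among the `ζ` cheapest edges of `K_{A,B:F}` at `b_j`. -/
def Nin {n : ℕ} (C : Fin n × Fin n → ℝ) (F0 F1 : Finset (Fin n × Fin n)) (ζ : ℕ)
    (j : Fin n) : Set (Fin n) :=
  {i | EdgeKF F0 F1 i j ∧ {i' | EdgeKF F0 F1 i' j ∧ C (i', j) < C (i, j)}.ncard < ζ}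

/-- Forward arcs `(a_i, b_j)` of the digraph `D⃗_F(C,π)`. -/
def ForwardArc {n : ℕ} (C : Fin n × Fin n → ℝ) (F0 F1 : Finset (Fin n × Fin n)) (ζ : ℕ)
    (i j : Fin n) : Prop :=
  (i, j) ∉ F0 ∧ (i, j) ∉ F1 ∧ (i, j) ∉ Fhat0 F1 ∧ i ≠ j ∧
    (j ∈ Nout C F0 F1 ζ i ∨ i ∈ Nin C F0 F1 ζ j)

/-- The bipartite graph on `A ⊕ B` whose edges `(a_i, b_j)` are given by a set of pairs. -/
def bipGraph {n : ℕ} (T : Finset (Fin n × Fin n)) : SimpleGraph (Fin n ⊕ Fin n) :=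
  SimpleGraph.fromRel fun u v =>
    ∃ p ∈ T, u = Sum.inl (p : Fin n × Fin n).1 ∧ v = Sum.inr (p : Fin n × Fin n).2

/-- Arcs of the contraction `φ(T)`: an arc `(i₁, i₂)` for every non-matching
edge `(a_{i₁}, b_{π i₂})` of `T`. -/
def contractionArcs {n : ℕ} (π : Equiv.Perm (Fin n)) (T : Finset (Fin n × Fin n)) :
    Set (Fin n × Fin n) :=
  {q | (q.1, π q.2) ∈ T ∧ q.1 ≠ q.2}

/-- The contraction `φ(T)` as an (undirected) graph on `[n]`: an edge `{i₁, i₂}` for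
every non-matching edge `(a_{i₁}, b_{π i₂})` of `T`. -/
def contractGraph {n : ℕ} (π : Equiv.Perm (Fin n)) (T : Finset (Fin n × Fin n)) :
    SimpleGraph (Fin n) :=
  SimpleGraph.fromRel fun i₁ i₂ => (i₁, π i₂) ∈ T


namespace LT

lemma exp_neg_one_le : Real.exp (-1) ≤ 0.3679 := by
  rw [Real.exp_neg]
  have := Real.exp_one_gt_d9
  rw [inv_le_comm₀ (Real.exp_pos _) (by norm_num)]
  linarith [show (0.3679:ℝ)⁻¹ ≤ 2.7182818283 by norm_num]

lemma exp_neg_quarter_le : Real.exp (-(1/4)) ≤ 0.779 := by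
  have h : Real.exp (-(1/4)) ^ 4 = Real.exp (-1) := by
    rw [← Real.exp_nat_mul]; norm_num
  have h2 := exp_neg_one_le
  by_contra hc
  push Not at hc
  have : (0.779:ℝ)^4 < Real.exp (-(1/4)) ^ 4 := pow_lt_pow_left₀ hc (by norm_num) (by norm_num)
  rw [h] at this
  norm_num at this h2
  linarith

lemma poly_ineq (x : ℝ) (h1 : x ≤ 1) :
    0.3679 * x + 0.6321 * x^5 ≤ 0.221 + 0.779 * x^4 := by
  -- factor 1-x
  have key : 0.221 + 0.779 * x^4 - (0.3679 * x + 0.6321 * x^5)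
      = (1 - x) * (0.221 - 0.1469 * (x + x^2 + x^3) + 0.6321 * x^4) := by ring
  have hq : 0 ≤ 0.221 - 0.1469 * (x + x^2 + x^3) + 0.6321 * x^4 := by
    nlinarith [sq_nonneg (x^2 - 0.4), sq_nonneg (x^2 - x/2), sq_nonneg (x-0.6), sq_nonneg (x^2-0.5*x-0.1), sq_nonneg (x^2-0.3*x-0.2)]
  nlinarith [mul_nonneg (sub_nonneg.2 h1) hq]

lemma exp_chord (c z : ℝ) (h0 : 0 ≤ z) (h1 : z ≤ 1) :
    Real.exp (c * z) ≤ 1 - z + z * Real.exp c := by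
  have := convexOn_exp.2 (Set.mem_univ 0) (Set.mem_univ c) (sub_nonneg.2 h1) h0 (by ring)
  simp only [smul_eq_mul, mul_zero, zero_add, Real.exp_zero, mul_one] at this
  rwa [mul_comm]

lemma star (α : ℝ) (h0 : 0 < α) (h1 : α ≤ 1) :
    (1 - α) * Real.exp (-(1/4)) + Real.exp (α - 1) * Real.exp ((1/4) * Real.log α) ≤ 1 := by
  set x := Real.exp ((1/4) * Real.log α) with hx
  have hx0 : 0 < x := Real.exp_pos _
  have hx4 : x^4 = α := by
    rw [hx, ← Real.exp_nat_mul]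
    rw [show ((4:ℕ):ℝ) * (1/4 * Real.log α) = Real.log α by push_cast; ring, Real.exp_log h0]
  have hx1 : x ≤ 1 := by
    rw [hx]; apply Real.exp_le_one_iff.2
    have := Real.log_nonpos h0.le h1
    linarith
  have hE : Real.exp (α - 1) ≤ 0.3679 + 0.6321 * α := by
    have := exp_chord (-1) (1 - α) (by linarith) (by linarith)
    rw [show -1 * (1 - α) = α - 1 by ring] at this
    have h2 := exp_neg_one_le
    nlinarith
  have hD := exp_neg_quarter_le
  have hp := poly_ineq x hx1
  have h5 : Real.exp (α - 1) * x ≤ (0.3679 + 0.6321 * α) * x :=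
    mul_le_mul_of_nonneg_right hE hx0.le
  have h6 : (1 - α) * Real.exp (-(1/4)) ≤ (1 - α) * 0.779 :=
    mul_le_mul_of_nonneg_left hD (by linarith)
  have h7 : α * x = x^5 := by rw [← hx4]; ring
  nlinarith

/-- The supersolution. -/
noncomputable def Hf (n a d : ℕ) : ℝ :=
  ((a - 1).factorial : ℝ) / ((n - 1).factorial : ℝ) *
    Real.exp (((n:ℝ) - d) * (1 - Real.log n) + ((n:ℝ) - a) / 4 + (d:ℝ) / 4 * Real.log ((a:ℝ) / n))

lemma Hf_pos (n a d : ℕ) : 0 < Hf n a d := by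
  unfold Hf; positivity

lemma Hf_succ_a (n a d : ℕ) (ha : 1 ≤ a) (han : a < n) :
    Hf n (a+1) d ≤ Hf n a d * (a * Real.exp (-(1/4) * (1 - (d:ℝ)/a))) := by
  unfold Hf
  have hn : (0:ℝ) < n := by exact_mod_cast (by omega : 0 < n)
  have ha' : (0:ℝ) < a := by exact_mod_cast ha
  have hf : ((a + 1 - 1).factorial : ℝ) = a * ((a-1).factorial : ℝ) := by
    obtain ⟨b, rfl⟩ : ∃ b, a = b + 1 := ⟨a - 1, by omega⟩
    simp [Nat.factorial_succ]
  rw [hf]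
  have hlog : Real.log (((a+1:ℕ):ℝ)/n) ≤ Real.log ((a:ℝ)/n) + 1/a := by
    have : ((a+1:ℕ):ℝ)/n = (a:ℝ)/n * (1 + 1/a) := by
      push_cast; field_simp
    rw [this, Real.log_mul (by positivity) (by positivity)]
    have := Real.log_le_sub_one_of_pos (show (0:ℝ) < 1 + 1/a by positivity)
    linarith
  calc _ = ((a - 1).factorial : ℝ) / ((n - 1).factorial : ℝ) * a * Real.exp (((n:ℝ) - d) * (1 - Real.log n) + ((n:ℝ) - (a+1:ℕ)) / 4 + (d:ℝ) / 4 * Real.log (((a+1:ℕ):ℝ) / n)) := by ring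
    _ ≤ ((a - 1).factorial : ℝ) / ((n - 1).factorial : ℝ) * a * Real.exp ((((n:ℝ) - d) * (1 - Real.log n) + ((n:ℝ) - a) / 4 + (d:ℝ) / 4 * Real.log ((a:ℝ) / n)) + (-(1/4) * (1 - (d:ℝ)/a))) := by
        refine mul_le_mul_of_nonneg_left (Real.exp_le_exp.2 ?_) (by positivity)
        have : (d:ℝ)/4 * Real.log (((a+1:ℕ):ℝ)/n) ≤ (d:ℝ)/4 * (Real.log ((a:ℝ)/n) + 1/a) := by gcongr
        push_cast at this ⊢
        have e : (d:ℝ)/4 * (Real.log ((a:ℝ)/n) + 1/a) = (d:ℝ)/4 * Real.log ((a:ℝ)/n) + 1/4 * ((d:ℝ)/a) := by ring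
        linarith
    _ = _ := by rw [Real.exp_add]; ring

lemma Hf_succ_d (n a d : ℕ) (hn : 1 ≤ n) :
    Hf n a (d+1) = Hf n a d * (n * Real.exp (-1) * Real.exp ((1/4) * Real.log ((a:ℝ)/n))) := by
  unfold Hf
  have hn' : (0:ℝ) < n := by exact_mod_cast hn
  have e : (n:ℝ) * Real.exp (-1) * Real.exp ((1/4) * Real.log ((a:ℝ)/n)) =
      Real.exp (Real.log n + (-1) + (1/4) * Real.log ((a:ℝ)/n)) := by
    rw [Real.exp_add, Real.exp_add, Real.exp_log hn']
  rw [e, mul_assoc, ← Real.exp_add]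
  congr 2
  push_cast; ring

lemma Hf_step (n a d : ℕ) (ha : 1 ≤ a) (han : a ≤ n) (hda : d ≤ a) (hdn : d < n) :
    ((n:ℝ) - a) * (1 / ((a:ℝ) * ((n:ℝ) - d)) * Hf n (a+1) d) +
      ((a:ℝ) - d) * (Real.exp ((a:ℝ)/n) / ((a:ℝ) * ((n:ℝ) - d)) * Hf n a (d+1)) ≤ Hf n a d := by
  have hn : (0:ℝ) < n := by exact_mod_cast (by omega : 0 < n)
  have ha' : (0:ℝ) < a := by exact_mod_cast ha
  have hdn' : (0:ℝ) < (n:ℝ) - d := by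
    have : (d:ℝ) < n := by exact_mod_cast hdn
    linarith
  have han' : (0:ℝ) ≤ (n:ℝ) - a := by
    have : (a:ℝ) ≤ n := by exact_mod_cast han
    linarith
  have hda' : (d:ℝ) ≤ a := by exact_mod_cast hda
  have hH := Hf_pos n a d
  set z : ℝ := 1 - (d:ℝ)/a with hz
  have hz0 : 0 ≤ z := by rw [hz, sub_nonneg]; exact div_le_one_of_le₀ hda' ha'.le
  have hz1 : z ≤ 1 := by rw [hz]; have : 0 ≤ (d:ℝ)/a := by positivity
                         linarith
  set α : ℝ := (a:ℝ)/n with hα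
  have hα0 : 0 < α := by positivity
  have hα1 : α ≤ 1 := by rw [hα]; exact div_le_one_of_le₀ (by linarith) hn.le
  have e1 : ((n:ℝ) - a) * (1 / ((a:ℝ) * ((n:ℝ) - d)) * Hf n (a+1) d) ≤
      Hf n a d * (n / ((n:ℝ) - d)) * ((1 - α) * Real.exp (-(1/4) * z)) := by
    rcases han.eq_or_lt with h | h
    · have : (n:ℝ) - a = 0 := by rw [h]; ring
      rw [this, zero_mul]
      have : 0 ≤ 1 - α := by linarith
      positivity
    · calc _ ≤ ((n:ℝ) - a) * (1 / ((a:ℝ) * ((n:ℝ) - d)) * (Hf n a d * (a * Real.exp (-(1/4) * z)))) := by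
            gcongr
            exact Hf_succ_a n a d ha h
        _ = _ := by rw [hα]; field_simp
  have e2 : ((a:ℝ) - d) * (Real.exp ((a:ℝ)/n) / ((a:ℝ) * ((n:ℝ) - d)) * Hf n a (d+1)) =
      Hf n a d * (n / ((n:ℝ) - d)) * (z * (Real.exp (α - 1) * Real.exp ((1/4) * Real.log α))) := by
    rw [Hf_succ_d n a d (by omega), sub_eq_add_neg α 1, Real.exp_add, hz, hα]
    field_simp
  rw [e2]
  refine (add_le_add_left e1 _).trans ?_
  rw [← mul_add]
  have hc := exp_chord (-(1/4)) z hz0 hz1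
  have hs := star α hα0 hα1
  have key : (1 - α) * Real.exp (-(1/4) * z) + z * (Real.exp (α - 1) * Real.exp ((1/4) * Real.log α)) ≤ 1 - α + α * z := by
    nlinarith [mul_le_mul_of_nonneg_left hc (sub_nonneg.2 hα1), mul_le_mul_of_nonneg_left hs hz0]
  calc _ ≤ Hf n a d * (n / ((n:ℝ) - d)) * (1 - α + α * z) := by gcongr
    _ = _ := by rw [hα, hz]; field_simp; ring

end LT

namespace LT

/-- number of items with count at least one -/
def cA {n : ℕ} (c : Fin n → ℕ) : ℕ := #{x | 1 ≤ c x}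
/-- number of items with count at least two -/
def cD {n : ℕ} (c : Fin n → ℕ) : ℕ := #{x | 2 ≤ c x}

/-- step weight -/
noncomputable def wt {n : ℕ} (c : Fin n → ℕ) (x : Fin n) : ℝ :=
  if c x = 0 then (if cA c = 0 then 1 else 1 / ((cA c : ℝ) * ((n:ℝ) - cD c)))
  else if c x = 1 then Real.exp ((cA c : ℝ) / n) / ((cA c : ℝ) * ((n:ℝ) - cD c))
  else 0

/-- partition function -/
noncomputable def Zf (n : ℕ) : ℕ → (Fin n → ℕ) → ℝ
  | 0, _ => 1
  | (k+1), c => ∑ x, wt c x * Zf n k (c + Pi.single x 1)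

lemma cA_le_n {n : ℕ} (c : Fin n → ℕ) : cA c ≤ n := by
  unfold cA; simpa using Finset.card_le_univ (α := Fin n) {x | 1 ≤ c x}

lemma cD_le_n {n : ℕ} (c : Fin n → ℕ) : cD c ≤ n := by
  unfold cD; simpa using Finset.card_le_univ (α := Fin n) {x | 2 ≤ c x}

lemma cD_le {n : ℕ} (c : Fin n → ℕ) : (cD c : ℝ) ≤ n := by
  exact_mod_cast cD_le_n c

lemma wt_nonneg {n : ℕ} (c : Fin n → ℕ) (x : Fin n) : 0 ≤ wt c x := by
  have : 0 ≤ (n:ℝ) - cD c := sub_nonneg.2 (cD_le c)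
  unfold wt; split_ifs <;> positivity

lemma sum_eq_cA_cD {n : ℕ} (c : Fin n → ℕ) (hc : ∀ x, c x ≤ 2) : ∑ x, c x = cA c + cD c := by
  unfold cA cD
  rw [Finset.card_filter, Finset.card_filter, ← Finset.sum_add_distrib]
  refine Finset.sum_congr rfl fun x _ => ?_
  have := hc x
  split_ifs <;> omega

lemma cA_add {n : ℕ} (c : Fin n → ℕ) (x : Fin n) (hx : c x = 0) :
    cA (c + Pi.single x 1) = cA c + 1 ∧ cD (c + Pi.single x 1) = cD c := by
  constructor
  · unfold cA
    rw [← Finset.card_insert_of_notMem (a := x) (by simp [hx])]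
    congr 1; ext y
    by_cases h : y = x
    · subst h; simp
    · simp [h]
  · unfold cD
    congr 1; ext y
    by_cases h : y = x
    · subst h; simp [hx]
    · simp [h]

lemma cD_add {n : ℕ} (c : Fin n → ℕ) (x : Fin n) (hx : c x = 1) :
    cA (c + Pi.single x 1) = cA c ∧ cD (c + Pi.single x 1) = cD c + 1 := by
  constructor
  · unfold cA
    congr 1; ext y
    by_cases h : y = x
    · subst h; simp [hx]
    · simp [h]
  · unfold cD
    rw [← Finset.card_insert_of_notMem (a := x) (by simp [hx])]
    congr 1; ext y
    by_cases h : y = x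
    · subst h; simp [hx]
    · simp [h]

lemma Zf_nonneg (n k : ℕ) (c : Fin n → ℕ) : 0 ≤ Zf n k c := by
  induction k generalizing c with
  | zero => simp [Zf]
  | succ k ih => exact Finset.sum_nonneg fun x _ => mul_nonneg (wt_nonneg _ _) (ih _)

lemma Zf_bound (n : ℕ) (hn : 1 ≤ n) (k : ℕ) (c : Fin n → ℕ) (hc : ∀ x, c x ≤ 2)
    (hs : ∑ x, c x + k = 2 * n) :
    Zf n k c ≤ if cA c = 0 then n * Hf n 1 0 else Hf n (cA c) (cD c) := by
  induction k generalizing c with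
  | zero =>
    rw [sum_eq_cA_cD c hc] at hs
    have h1 := cA_le_n c
    have h2 := cD_le_n c
    have h3 : cA c = n := by omega
    have h4 : cD c = n := by omega
    have hn0 : (n:ℝ) ≠ 0 := by exact_mod_cast (by omega : n ≠ 0)
    rw [h3, h4, if_neg (by omega)]
    simp [Zf, Hf, hn0, Nat.factorial_ne_zero]
  | succ k ih =>
    have hstep : ∀ x, c x ≤ 1 → Zf n k (c + Pi.single x 1) ≤
        if cA (c + Pi.single x 1) = 0 then n * Hf n 1 0 else
          Hf n (cA (c + Pi.single x 1)) (cD (c + Pi.single x 1)) := by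
      intro x hx
      apply ih
      · intro y
        by_cases h : y = x
        · subst h; simp; omega
        · simp [h, hc y]
      · simp [Finset.sum_add_distrib]; omega
    rw [sum_eq_cA_cD c hc] at hs
    split_ifs with ha
    · have hc0 : ∀ x, c x = 0 := by
        intro x
        unfold cA at ha
        rw [Finset.card_eq_zero, Finset.filter_eq_empty_iff] at ha
        have := ha (Finset.mem_univ x); omega
      have hd : cD c = 0 := by unfold cD; simp [hc0]
      calc Zf n (k+1) c = ∑ x, wt c x * Zf n k (c + Pi.single x 1) := rfl
        _ ≤ ∑ x : Fin n, Hf n 1 0 := by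
            refine Finset.sum_le_sum fun x _ => ?_
            have h1 := hstep x (by simp [hc0])
            obtain ⟨h2, h3⟩ := cA_add c x (hc0 x)
            rw [h2, h3, ha, hd] at h1
            simpa [wt, hc0, ha] using h1
        _ = _ := by simp
    · have hD : cD c ≤ cA c := by
        unfold cD cA; apply Finset.card_le_card; intro x; simp; omega
      have hA := cA_le_n c
      have hDn : cD c < n := by omega
      have h0card : (#{x | c x = 0} : ℝ) = (n:ℝ) - cA c := by
        have : #{x | c x = 0} + cA c = n := by
          unfold cA
          have := Finset.card_filter_add_card_filter_not (s := (Finset.univ : Finset (Fin n))) (fun x => c x = 0)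
          simp only [Finset.card_univ, Fintype.card_fin] at this
          refine Eq.trans ?_ this; congr 2; ext x; simp; omega
        rw [eq_sub_iff_add_eq]; exact_mod_cast this
      have h1card : (#{x | c x = 1} : ℝ) = (cA c : ℝ) - cD c := by
        have : #{x | c x = 1} + cD c = cA c := by
          unfold cA cD
          rw [← Finset.card_union_of_disjoint]
          · congr 1; ext x; simp; omega
          · rw [Finset.disjoint_filter]; intro x; omega
        rw [eq_sub_iff_add_eq]; exact_mod_cast this
      have hDn' : 0 ≤ (n:ℝ) - cD c := sub_nonneg.2 (cD_le c)
      calc Zf n (k+1) c = ∑ x, wt c x * Zf n k (c + Pi.single x 1) := rfl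
        _ ≤ ∑ x : Fin n, ((if c x = 0 then 1 / ((cA c : ℝ) * ((n:ℝ) - cD c)) * Hf n (cA c + 1) (cD c) else 0) +
              (if c x = 1 then Real.exp ((cA c : ℝ)/n) / ((cA c : ℝ) * ((n:ℝ) - cD c)) * Hf n (cA c) (cD c + 1) else 0)) := by
            refine Finset.sum_le_sum fun x _ => ?_
            by_cases h0 : c x = 0
            · have h1 := hstep x (by omega)
              obtain ⟨h2, h3⟩ := cA_add c x h0
              rw [h2, h3, if_neg (by omega)] at h1
              simp only [wt, h0, ha, if_true, if_false]
              simp only [zero_ne_one, if_false, add_zero]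
              gcongr
            · by_cases h1 : c x = 1
              · have h4 := hstep x (by omega)
                obtain ⟨h2, h3⟩ := cD_add c x h1
                rw [h2, h3, if_neg (by omega)] at h4
                simp only [wt, h1, if_true, if_false, one_ne_zero, zero_add]
                gcongr
              · simp [wt, h0, h1]
        _ = ((n:ℝ) - cA c) * (1 / ((cA c:ℝ) * ((n:ℝ) - cD c)) * Hf n (cA c+1) (cD c)) +
      ((cA c:ℝ) - cD c) * (Real.exp ((cA c:ℝ)/n) / ((cA c:ℝ) * ((n:ℝ) - cD c)) * Hf n (cA c) (cD c+1)) := by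
            rw [Finset.sum_add_distrib, ← Finset.sum_filter, ← Finset.sum_filter, Finset.sum_const,
              Finset.sum_const, nsmul_eq_mul, nsmul_eq_mul, h0card, h1card]
        _ ≤ _ := Hf_step n (cA c) (cD c) (by omega) hA hD hDn

/-- counts before time s -/
def cnt {n k : ℕ} (ω : Fin k → Fin n) (s : Fin k) : Fin n → ℕ := fun y => #{t | t < s ∧ ω t = y}

lemma Zf_eq (n k : ℕ) (c : Fin n → ℕ) :
    Zf n k c = ∑ ω : Fin k → Fin n, ∏ s, wt (c + cnt ω s) (ω s) := by
  induction k generalizing c with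
  | zero => simp [Zf]
  | succ k ih =>
    rw [Zf]
    rw [← (Fin.consEquiv (fun _ => Fin n)).sum_comp, Fintype.sum_prod_type]
    refine Finset.sum_congr rfl fun x _ => ?_
    rw [ih, Finset.mul_sum]
    refine Finset.sum_congr rfl fun ω _ => ?_
    rw [Fin.prod_univ_succ]
    have h0 : cnt (Fin.cons x ω : Fin (k+1) → Fin n) 0 = 0 := by
      ext y; simp [cnt]
    have h1 : ∀ s : Fin k, cnt (Fin.cons x ω : Fin (k+1) → Fin n) s.succ = Pi.single x 1 + cnt ω s := by
      intro s
      ext y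
      simp only [cnt, Pi.add_apply]
      rw [Finset.card_filter, Fin.sum_univ_succ, Finset.card_filter]
      congr 1
      · simp [Pi.single_apply, eq_comm]
      · simp
    have hce : (Fin.consEquiv fun _ => Fin n) (x, ω) = (Fin.cons x ω : Fin (k+1) → Fin n) := rfl
    rw [hce]
    simp only [Fin.cons_zero, Fin.cons_succ, h0, h1, add_zero, add_assoc]

/-- rows in the initial segment of length t -/
def arow {n : ℕ} (e : Fin (2*n) ≃ Fin n × Bool) (t : ℕ) : ℕ := #{i | (e.symm (i, false)).val < t}
/-- columns in the initial segment of length t -/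
def dcol {n : ℕ} (e : Fin (2*n) ≃ Fin n × Bool) (t : ℕ) : ℕ := #{i | (e.symm (i, true)).val < t}
/-- each row precedes its partner column -/
def Valid {n : ℕ} (e : Fin (2*n) ≃ Fin n × Bool) : Prop := ∀ i, e.symm (i, false) < e.symm (i, true)

instance {n : ℕ} : DecidablePred (Valid (n := n)) := fun e => by unfold Valid; infer_instance

lemma cnt_eq {n : ℕ} (e : Fin (2*n) ≃ Fin n × Bool) (s : Fin (2*n)) (y : Fin n) :
    cnt (fun t => (e t).1) s y = (if e.symm (y, false) < s then 1 else 0) + (if e.symm (y, true) < s then 1 else 0) := by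
  unfold cnt
  rw [Finset.card_filter, ← e.symm.sum_comp, Fintype.sum_prod_type, Finset.sum_eq_single y]
  · simp only [Equiv.apply_symm_apply, and_true, Fintype.sum_bool]
    rw [add_comm]
  · intro b _ hb; simp [hb]
  · simp

lemma valid_inj {n : ℕ} (e e' : Fin (2*n) ≃ Fin n × Bool) (h : Valid e) (h' : Valid e')
    (hh : (fun t => (e t).1) = fun t => (e' t).1) : e = e' := by
  ext1 t
  have h1 : (e t).1 = (e' t).1 := congrFun hh t
  refine Prod.ext h1 ?_
  have c1 := cnt_eq e t (e t).1
  have c2 := cnt_eq e' t (e t).1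
  rw [hh] at c1
  rw [c1, h1] at c2
  have v1 := h (e' t).1
  have v2 := h' (e' t).1
  rcases hb : (e t).2 with _ | _ <;> rcases hb' : (e' t).2 with _ | _ <;> try rfl
  · have e1 : e.symm ((e' t).1, false) = t := by rw [← h1, ← hb]; simp
    have e2 : e'.symm ((e' t).1, true) = t := by rw [← hb']; simp
    rw [e1] at c2 v1; rw [e2] at c2 v2
    simp [v2, not_lt.2 v1.le] at c2
  · have e1 : e.symm ((e' t).1, true) = t := by rw [← h1, ← hb]; simp
    have e2 : e'.symm ((e' t).1, false) = t := by rw [← hb']; simp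
    rw [e1] at c2 v1; rw [e2] at c2 v2
    simp [v1, not_lt.2 v2.le] at c2

/-- weight of a step in the order -/
noncomputable def ew {n : ℕ} (e : Fin (2*n) ≃ Fin n × Bool) (t : Fin (2*n)) : ℝ :=
  (if t.val = 0 then 1 else 1 / ((arow e t : ℝ) * ((n:ℝ) - dcol e t))) *
    (if (e t).2 = true then Real.exp ((arow e t : ℝ) / n) else 1)

lemma ew_eq {n : ℕ} (e : Fin (2*n) ≃ Fin n × Bool) (he : Valid e) (t : Fin (2*n)) :
    ew e t = wt (cnt (fun t => (e t).1) t) (e t).1 := by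
  have hA : cA (cnt (fun t => (e t).1) t) = arow e t := by
    unfold cA arow
    congr 1; ext y
    simp only [cnt_eq, Finset.mem_filter, Finset.mem_univ, true_and, Fin.lt_def]
    have := he y
    rw [Fin.lt_def] at this
    split_ifs <;> simp <;> omega
  have hD : cD (cnt (fun t => (e t).1) t) = dcol e t := by
    unfold cD dcol
    congr 1; ext y
    simp only [cnt_eq, Finset.mem_filter, Finset.mem_univ, true_and, Fin.lt_def]
    have := he y
    rw [Fin.lt_def] at this
    split_ifs <;> simp <;> omega
  have hv := he (e t).1
  have hA0 : t.val ≠ 0 → arow e t ≠ 0 := by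
    intro h0 h
    unfold arow at h
    rw [Finset.card_eq_zero, Finset.filter_eq_empty_iff] at h
    have hpos : 0 < 2 * n := t.pos
    have h1 := h (Finset.mem_univ (e ⟨0, hpos⟩).1)
    have h2 := he (e ⟨0, hpos⟩).1
    rcases hb : (e ⟨0, hpos⟩).2 with _ | _
    · rw [← hb] at h1; simp at h1; omega
    · rw [← hb] at h2; simp [Fin.lt_def] at h2
  unfold ew wt
  rw [hA, hD, cnt_eq]
  rcases hb : (e t).2 with _ | _
  · have e1 : e.symm ((e t).1, false) = t := by rw [← hb]; simp
    rw [e1] at hv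
    rw [e1]
    simp only [lt_irrefl, if_false, zero_add, not_lt.2 hv.le]
    by_cases h0 : t.val = 0
    · have : arow e t = 0 := by simp [arow, h0]
      simp [h0, arow]
    · simp [h0, hA0 h0]
  · have e1 : e.symm ((e t).1, true) = t := by rw [← hb]; simp
    rw [e1] at hv
    rw [e1]
    have h0 : t.val ≠ 0 := by rw [Fin.lt_def] at hv; omega
    simp only [lt_irrefl, if_false, add_zero, hv, if_true, h0]
    simp only [one_ne_zero, if_false]
    rw [one_div_mul_eq_div]

lemma sum_orders (n : ℕ) (hn : 1 ≤ n) :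
    ∑ e : Fin (2*n) ≃ Fin n × Bool with Valid e, ∏ t, ew e t ≤ n * Hf n 1 0 := by
  have h1 := Zf_bound n hn (2*n) 0 (by simp) (by simp)
  rw [if_pos (by simp [cA]), Zf_eq] at h1
  refine le_trans ?_ h1
  have : ∑ e : Fin (2*n) ≃ Fin n × Bool with Valid e, ∏ t, ew e t =
      ∑ ω ∈ (Finset.univ.filter fun e : Fin (2*n) ≃ Fin n × Bool => Valid e).image (fun e t => (e t).1),
        ∏ s, wt (0 + cnt ω s) (ω s) := by
    rw [Finset.sum_image]
    · refine Finset.sum_congr rfl fun e he => Finset.prod_congr rfl fun t _ => ?_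
      rw [ew_eq e (by simpa using he), zero_add]
    · intro e he e' he' hh
      exact valid_inj e e' (by simpa using he) (by simpa using he') hh
  rw [this]
  exact Finset.sum_le_univ_sum_of_nonneg fun ω => Finset.prod_nonneg fun s _ => wt_nonneg _ _

end LT

namespace LT

/-- permanent -/
noncomputable def pm {n : ℕ} (A : Fin n → Fin n → ℝ) : ℝ := ∑ σ : Equiv.Perm (Fin n), ∏ i, A i (σ i)

/-- extend a permutation of the minor -/
def extP {n : ℕ} (i j : Fin (n+1)) (τ : Equiv.Perm (Fin n)) : Equiv.Perm (Fin (n+1)) :=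
  (finSuccEquiv' i).trans ((Equiv.optionCongr τ).trans (finSuccEquiv' j).symm)

lemma extP_self {n : ℕ} (i j : Fin (n+1)) (τ : Equiv.Perm (Fin n)) : extP i j τ i = j := by
  simp [extP]

lemma extP_succAbove {n : ℕ} (i j : Fin (n+1)) (τ : Equiv.Perm (Fin n)) (k : Fin n) :
    extP i j τ (i.succAbove k) = j.succAbove (τ k) := by
  simp [extP]

/-- minor -/
def minor {n : ℕ} (A : Fin (n+1) → Fin (n+1) → ℝ) (i j : Fin (n+1)) : Fin n → Fin n → ℝ :=
  fun k l => A (i.succAbove k) (j.succAbove l)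

lemma extP_prod {n : ℕ} (A : Fin (n+1) → Fin (n+1) → ℝ) (i j : Fin (n+1)) (τ : Equiv.Perm (Fin n)) :
    ∏ k, A k (extP i j τ k) = A i j * ∏ k, minor A i j k (τ k) := by
  rw [Fin.prod_univ_succAbove _ i, extP_self]
  simp only [extP_succAbove, minor]

lemma extP_inj {n : ℕ} (i j : Fin (n+1)) (τ τ' : Equiv.Perm (Fin n)) (h : extP i j τ = extP i j τ') : τ = τ' := by
  ext1 k
  have := congrArg (fun s : Equiv.Perm (Fin (n+1)) => s (i.succAbove k)) h
  simpa [extP_succAbove] using this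

lemma pm_row {n : ℕ} (A : Fin (n+1) → Fin (n+1) → ℝ) (i : Fin (n+1)) :
    pm A = ∑ j, A i j * pm (minor A i j) := by
  have hb : Function.Bijective (fun x : Fin (n+1) × Equiv.Perm (Fin n) => extP i x.1 x.2) := by
    rw [Fintype.bijective_iff_injective_and_card]
    constructor
    · rintro ⟨j, τ⟩ ⟨j', τ'⟩ h
      simp only at h
      have h1 : j = j' := by rw [← extP_self i j τ, h, extP_self]
      subst h1
      rw [extP_inj i j τ τ' h]
    · simp [Fintype.card_perm, Nat.factorial_succ]
  unfold pm
  rw [← hb.sum_comp, Fintype.sum_prod_type]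
  simp only [extP_prod, Finset.mul_sum]

lemma pm_col {n : ℕ} (A : Fin (n+1) → Fin (n+1) → ℝ) (j : Fin (n+1)) :
    pm A = ∑ i, A i j * pm (minor A i j) := by
  have hb : Function.Bijective (fun x : Fin (n+1) × Equiv.Perm (Fin n) => extP x.1 j x.2) := by
    rw [Fintype.bijective_iff_injective_and_card]
    constructor
    · rintro ⟨i, τ⟩ ⟨i', τ'⟩ h
      simp only at h
      have h1 : i = i' := by
        apply (extP i j τ).injective
        rw [extP_self, h, extP_self]
      subst h1
      rw [extP_inj i j τ τ' h]
    · simp [Fintype.card_perm, Nat.factorial_succ]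
  unfold pm
  rw [← hb.sum_comp, Fintype.sum_prod_type]
  simp only [extP_prod, Finset.mul_sum]

/-- additive constant in the permanent bound -/
noncomputable def Lc : ℕ → ℝ
  | 0 => Real.log 2 - 1
  | (n+1) => Lc n + (Real.log (2 * ((n:ℝ) + 2)) - 1) + 1 / ((n:ℝ) + 1)

lemma log_tan (x c : ℝ) (hx : 0 < x) (hc : 0 < c) : Real.log x ≤ Real.log c - 1 + x / c := by
  have := Real.log_le_sub_one_of_pos (div_pos hx hc)
  rw [Real.log_div hx.ne' hc.ne'] at this
  linarith

lemma pm_pos {n : ℕ} (A : Fin n → Fin n → ℝ) (hA : ∀ i j, 1 ≤ A i j) : 0 < pm A := by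
  unfold pm
  exact Finset.sum_pos (fun σ _ => Finset.prod_pos fun i _ => by linarith [hA i (σ i)]) ⟨1, by simp⟩

lemma minor_sum {n : ℕ} (A : Fin (n+1) → Fin (n+1) → ℝ) (i j : Fin (n+1)) :
    ∑ k, ∑ l, minor A i j k l = ∑ k, ∑ l, A k l - ∑ l, A i l - ∑ k, A k j + A i j := by
  have h1 : ∑ k, ∑ l, A k l = ∑ l, A i l + ∑ k : Fin n, ∑ l, A (i.succAbove k) l :=
    Fin.sum_univ_succAbove _ i
  have h2 : ∀ k : Fin n, ∑ l, A (i.succAbove k) l = A (i.succAbove k) j + ∑ l, minor A i j k l := by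
    intro k; exact Fin.sum_univ_succAbove _ j
  have h3 : ∑ k, A k j = A i j + ∑ k : Fin n, A (i.succAbove k) j := Fin.sum_univ_succAbove _ i
  rw [h1, Finset.sum_congr rfl fun k _ => h2 k, Finset.sum_add_distrib, h3]
  ring

lemma pm_bound (n : ℕ) (A : Fin (n+1) → Fin (n+1) → ℝ) (h1 : ∀ i j, 1 ≤ A i j) (h2 : ∀ i j, A i j ≤ 2) :
    Real.log (pm A) ≤ Lc n + (∑ i, ∑ j, A i j) / (2 * ((n:ℝ) + 1)) := by
  induction n with
  | zero =>
    have : pm A = A 0 0 := by simp [pm]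
    rw [this]
    have := log_tan (A 0 0) 2 (by linarith [h1 0 0]) (by norm_num)
    simpa [Lc] using this
  | succ n ih =>
    set N : ℝ := (n:ℝ) + 2 with hN
    have hNpos : 0 < N := by positivity
    have hn1 : (0:ℝ) < (n:ℝ) + 1 := by positivity
    set S := ∑ i, ∑ j, A i j with hS
    set P := pm A with hP
    have hPpos : 0 < P := pm_pos A h1
    set Q : Fin (n+1+1) → Fin (n+1+1) → ℝ := fun i j => pm (minor A i j) with hQ
    have hQpos : ∀ i j, 0 < Q i j := fun i j => pm_pos _ fun k l => h1 _ _
    set μ : Fin (n+1+1) → Fin (n+1+1) → ℝ := fun i j => A i j * Q i j / P with hμ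
    have hApos : ∀ i j, 0 < A i j := fun i j => by linarith [h1 i j]
    have hμ0 : ∀ i j, 0 ≤ μ i j := fun i j => by have := hApos i j; have := hQpos i j; positivity
    have hrow : ∀ i, ∑ j, μ i j = 1 := by
      intro i
      rw [← Finset.sum_div, ← pm_row A i, div_self hPpos.ne']
    have hcol : ∀ j, ∑ i, μ i j = 1 := by
      intro j
      rw [← Finset.sum_div, ← pm_col A j, div_self hPpos.ne']
    set R : Fin (n+1+1) → ℝ := fun i => ∑ j, A i j with hR
    have hRpos : ∀ i, 0 < R i := fun i => Finset.sum_pos (fun j _ => hApos i j) ⟨0, by simp⟩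
    -- Jensen
    have hJ : ∀ i, Real.log P ≤ Real.log (R i) + ∑ j, μ i j * Real.log (Q i j) := by
      intro i
      have hm : 0 < P / R i := div_pos hPpos (hRpos i)
      have key : ∀ j, μ i j * (Real.log P - Real.log (R i)) + μ i j - A i j / R i ≤ μ i j * Real.log (Q i j) := by
        intro j
        have hl := log_tan (P / R i) (Q i j) hm (hQpos i j)
        rw [Real.log_div hPpos.ne' (hRpos i).ne'] at hl
        have := mul_le_mul_of_nonneg_left hl (hμ0 i j)
        have e : μ i j * (P / R i / Q i j) = A i j / R i := by
          have := (hQpos i j).ne'; have := (hRpos i).ne'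
          simp only [hμ]; field_simp
        rw [mul_add, mul_sub, e] at this
        linarith
      have := Finset.sum_le_sum (s := Finset.univ) fun j _ => key j
      rw [Finset.sum_sub_distrib, Finset.sum_add_distrib, ← Finset.sum_mul, hrow, ← Finset.sum_div] at this
      have e : (∑ j, A i j) / R i = 1 := div_self (hRpos i).ne'
      rw [e] at this
      linarith
    have hRlog : ∀ i, Real.log (R i) ≤ Real.log (2 * N) - 1 + R i / (2 * N) :=
      fun i => log_tan _ _ (hRpos i) (by positivity)
    have hQlog : ∀ i j, Real.log (Q i j) ≤ Lc n + (S - R i - (∑ k, A k j) + A i j) / (2 * ((n:ℝ)+1)) := by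
      intro i j
      have := ih (minor A i j) (fun _ _ => h1 _ _) (fun _ _ => h2 _ _)
      rwa [minor_sum] at this
    have hi : ∀ i, Real.log P ≤ Real.log (2 * N) - 1 + R i / (2 * N) + Lc n +
        (S - R i - (∑ j, μ i j * ∑ k, A k j) + 2) / (2 * ((n:ℝ)+1)) := by
      intro i
      have hb : ∑ j, μ i j * Real.log (Q i j) ≤ ∑ j, (μ i j * (Lc n + (S - R i + 2) / (2 * ((n:ℝ)+1))) -
          μ i j * (∑ k, A k j) / (2 * ((n:ℝ)+1))) := by
        refine Finset.sum_le_sum fun j _ => ?_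
        have h3 : Real.log (Q i j) ≤ Lc n + (S - R i - (∑ k, A k j) + 2) / (2 * ((n:ℝ)+1)) := by
          refine (hQlog i j).trans ?_
          gcongr
          exact h2 i j
        refine (mul_le_mul_of_nonneg_left h3 (hμ0 i j)).trans (le_of_eq ?_)
        ring
      rw [Finset.sum_sub_distrib, ← Finset.sum_mul, hrow, ← Finset.sum_div] at hb
      have := hJ i
      have := hRlog i
      have e : (S - R i - (∑ j, μ i j * ∑ k, A k j) + 2) / (2 * ((n:ℝ)+1)) =
        (S - R i + 2) / (2 * ((n:ℝ)+1)) - (∑ j, μ i j * ∑ k, A k j) / (2 * ((n:ℝ)+1)) := by ring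
      linarith
    have hsum := Finset.sum_le_sum (s := Finset.univ) fun i _ => hi i
    have hcc : ∑ i, ∑ j, μ i j * ∑ k, A k j = S := by
      rw [Finset.sum_comm]
      simp only [← Finset.sum_mul, hcol, one_mul]
      rw [Finset.sum_comm]
    have hRS : ∑ i, R i = S := rfl
    rw [Finset.sum_add_distrib, Finset.sum_add_distrib, Finset.sum_add_distrib, ← Finset.sum_div, ← Finset.sum_div,
      Finset.sum_add_distrib, Finset.sum_sub_distrib, Finset.sum_sub_distrib, hcc, hRS] at hsum
    simp only [Finset.sum_const, Finset.card_univ, Fintype.card_fin, nsmul_eq_mul] at hsum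
    have hcast : ((n+1+1 : ℕ) : ℝ) = N := by push_cast; rw [hN]; ring
    rw [hcast] at hsum
    have hRS2 : ∑ x, (S - R x) = N * S - S := by
      rw [Finset.sum_sub_distrib, hRS, ← hcast]; simp
    rw [hRS2] at hsum
    have hSpos : 0 ≤ S := Finset.sum_nonneg fun i _ => (hRpos i).le
    -- divide by N
    have hdiv : Real.log P ≤ (Real.log (2 * N) - 1) + S / (2 * N) / N + Lc n + (N * S - S - S + N * 2) / (2 * ((n:ℝ)+1)) / N := by
      have : N * Real.log P ≤ N * ((Real.log (2 * N) - 1) + S / (2 * N) / N + Lc n + (N * S - S - S + N * 2) / (2 * ((n:ℝ)+1)) / N) := by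
        refine hsum.trans (le_of_eq ?_)
        field_simp
      exact le_of_mul_le_mul_left this hNpos
    refine hdiv.trans ?_
    rw [Lc, ← hN]
    push_cast
    have hN1 : (n:ℝ) + 1 = N - 1 := by rw [hN]; ring
    have hN1' : 0 < N - 1 := by rw [← hN1]; exact hn1
    rw [show (n:ℝ) + 1 + 1 = N by rw [hN]; ring, hN1]
    have hfin : S / (2 * N) - (S / (2 * N) / N + (N * S - S - S + N * 2) / (2 * (N-1)) / N - 1 / (N-1)) = S / (2 * N * N * (N-1)) := by
      field_simp; ring
    have : 0 ≤ S / (2 * N * N * (N-1)) := by positivity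
    linarith

lemma Lc_eq (n : ℕ) : Lc n ≤ Real.log ((n+1).factorial : ℝ) + ((n:ℝ)+1) * (Real.log 2 - 1) + 1 + Real.log (n + 1) := by
  have h : Lc n = Real.log ((n+1).factorial : ℝ) + ((n:ℝ)+1) * (Real.log 2 - 1) + (harmonic n : ℝ) := by
    induction n with
    | zero => simp [Lc]
    | succ n ih =>
      rw [Lc, ih, harmonic_succ, Nat.factorial_succ (n+1), Real.log_mul (by norm_num) (by positivity)]
      push_cast
      rw [Real.log_mul (by positivity) (by positivity)]
      rw [show (n:ℝ) + 1 + 1 = n + 2 by ring]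
      ring
  rw [h]
  have h2 := harmonic_le_one_add_log n
  have h3 : Real.log (n:ℝ) ≤ Real.log (n+1) := by
    rcases Nat.eq_zero_or_pos n with h | h
    · subst h; simp
    · apply Real.log_le_log <;> [exact_mod_cast h; linarith]
  linarith

/-- final form -/
lemma pm_le (n : ℕ) (hn : 1 ≤ n) (A : Fin n → Fin n → ℝ) (h1 : ∀ i j, 1 ≤ A i j) (h2 : ∀ i j, A i j ≤ 2) :
    pm A ≤ (n.factorial : ℝ) * n * Real.exp 1 * Real.exp (n * (Real.log 2 - 1)) * Real.exp ((∑ i, ∑ j, A i j) / (2 * n)) := by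
  obtain ⟨m, rfl⟩ : ∃ m, n = m + 1 := ⟨n - 1, by omega⟩
  have hb := pm_bound m A h1 h2
  have hl := Lc_eq m
  rw [← Real.log_le_log_iff (pm_pos A h1) (by positivity)]
  rw [Real.log_mul (by positivity) (by positivity), Real.log_mul (by positivity) (by positivity),
    Real.log_mul (by positivity) (by positivity), Real.log_mul (by positivity) (by positivity), Real.log_exp, Real.log_exp, Real.log_exp]
  push_cast
  linarith

end LT

namespace LT

lemma near_count {n k : ℕ} (hk : k ≤ n) (g : Fin n → Fin n)
    (hg : n ≤ #(Finset.univ.image g) + k) :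
    k.factorial ≤ #{σ : Equiv.Perm (Fin n) | #{i | g i ≠ σ i} ≤ k} := by
  classical
  obtain ⟨T, hT1, hT2⟩ : ∃ T : Finset (Fin n), Finset.univ.image g = T.image g ∧ Set.InjOn g T := by
    obtain ⟨T, _, h2, h3⟩ := Finset.exists_subset_injOn_image_eq_of_surjOn (f := g) (s := Set.univ) (t := Finset.univ.image g) (by intro y; simp)
    exact ⟨T, h3.symm, h2⟩
  have hTc : #T = #(Finset.univ.image g) := by rw [hT1, Finset.card_image_of_injOn hT2]
  obtain ⟨U, hU, hUc⟩ := Finset.exists_subset_card_eq (s := T) (n := n - k) (by omega)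
  have hUinj : Set.InjOn g U := hT2.mono (by exact_mod_cast hU)
  obtain ⟨σ0, hσ0⟩ := Finset.exists_equiv_extend_of_card_eq (α := Fin n) (t := Finset.univ) (s := U) (f := g) (by simp) (by simp) hUinj
  let σ1 : Equiv.Perm (Fin n) := σ0.trans (Equiv.subtypeUnivEquiv (by simp))
  have hσ1 : ∀ i ∈ U, σ1 i = g i := fun i hi => hσ0 i hi
  have hcard : Fintype.card (Equiv.Perm {x // x ∉ U}) = k.factorial := by
    rw [Fintype.card_perm, Fintype.card_subtype_compl]
    simp [hUc]; congr 1; omega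
  rw [← hcard, ← Finset.card_univ]
  apply Finset.card_le_card_of_injOn (fun ρ => σ1 * Equiv.Perm.ofSubtype ρ)
  · intro ρ _
    simp only [Finset.coe_filter, Finset.mem_univ, true_and, Set.mem_ofPred_eq]
    have : ({i | g i ≠ (σ1 * Equiv.Perm.ofSubtype ρ) i} : Finset (Fin n)) ⊆ Uᶜ := by
      intro i
      simp only [Finset.mem_filter, Finset.mem_univ, true_and, Finset.mem_compl]
      intro h hi
      apply h
      rw [Equiv.Perm.mul_apply, Equiv.Perm.ofSubtype_apply_of_not_mem _ (by simpa using hi), hσ1 i hi]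
    have h2 := Finset.card_le_card this
    rw [Finset.card_compl, hUc, Fintype.card_fin] at h2
    omega
  · intro ρ _ ρ' _ h
    exact Equiv.Perm.ofSubtype_injective (mul_left_cancel h)

lemma near_sum {n k : ℕ} (q : Fin n → Fin n → ℝ) (h1 : ∀ i j, 1 ≤ q i j) (h2 : ∀ i j, q i j ≤ 2)
    (hk : k ≤ n) (σ : Fin n → Fin n) :
    ∑ g : Fin n → Fin n with #{i | g i ≠ σ i} ≤ k, ∏ i, q i (g i) ≤
      (n.choose k : ℝ) * (2 * n)^k * ∏ i, q i (σ i) := by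
  classical
  have hsub : (Finset.univ.filter fun g : Fin n → Fin n => #{i | g i ≠ σ i} ≤ k) ⊆
      (Finset.powersetCard k Finset.univ).biUnion fun E => Finset.univ.filter fun g : Fin n → Fin n => ∀ i ∉ E, g i = σ i := by
    intro g hg
    simp only [Finset.mem_filter, Finset.mem_univ, true_and] at hg
    obtain ⟨E, hE, _, hEc⟩ := Finset.exists_subsuperset_card_eq (Finset.subset_univ _) hg (by simpa using hk)
    simp only [Finset.mem_biUnion, Finset.mem_powersetCard, Finset.mem_filter, Finset.mem_univ, true_and]
    refine ⟨E, ⟨Finset.subset_univ _, hEc⟩, fun i hi => ?_⟩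
    by_contra h
    exact hi (hE (by simpa using h))
  have hq0 : ∀ i j, 0 ≤ q i j := fun i j => by linarith [h1 i j]
  have hterm : ∀ g : Fin n → Fin n, #{i | g i ≠ σ i} ≤ k → ∏ i, q i (g i) ≤ 2^k * ∏ i, q i (σ i) := by
    intro g hg
    calc ∏ i, q i (g i) ≤ ∏ i, ((if g i ≠ σ i then 2 else 1) * q i (σ i)) := by
          refine Finset.prod_le_prod (fun i _ => hq0 _ _) fun i _ => ?_
          split_ifs with h
          · linarith [h2 i (g i), h1 i (σ i)]
          · push Not at h; rw [h, one_mul]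
      _ = 2 ^ #{i | g i ≠ σ i} * ∏ i, q i (σ i) := by
          rw [Finset.prod_mul_distrib, ← Finset.prod_filter, Finset.prod_const]
      _ ≤ _ := by
          gcongr
          · exact Finset.prod_nonneg fun i _ => hq0 _ _
          · norm_num
  have hcard : #(Finset.univ.filter fun g : Fin n → Fin n => #{i | g i ≠ σ i} ≤ k) ≤ n.choose k * n^k := by
    refine (Finset.card_le_card hsub).trans (Finset.card_biUnion_le.trans ?_)
    calc _ ≤ ∑ E ∈ Finset.powersetCard k (Finset.univ : Finset (Fin n)), n^k := by
          refine Finset.sum_le_sum fun E hE => ?_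
          rw [Finset.mem_powersetCard] at hE
          have : Fintype.card ({x // x ∈ E} → Fin n) = n^k := by simp [hE.2]
          rw [← this, ← Finset.card_univ]
          apply Finset.card_le_card_of_injOn (fun g x => g x.1) (by simp)
          intro g hg g' hg' h
          simp only [Finset.coe_filter, Finset.mem_univ, true_and, Set.mem_ofPred_eq] at hg hg'
          ext1 i
          by_cases hi : i ∈ E
          · exact congrFun h ⟨i, hi⟩
          · rw [hg i hi, hg' i hi]
      _ = _ := by simp
  have hP : 0 ≤ ∏ i, q i (σ i) := Finset.prod_nonneg fun i _ => hq0 _ _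
  calc _ ≤ ∑ g : Fin n → Fin n with #{i | g i ≠ σ i} ≤ k, 2^k * ∏ i, q i (σ i) :=
        Finset.sum_le_sum fun g hg => hterm g (by simpa using hg)
    _ = (#(Finset.univ.filter fun g : Fin n → Fin n => #{i | g i ≠ σ i} ≤ k) : ℝ) * (2^k * ∏ i, q i (σ i)) := by
        rw [Finset.sum_const, nsmul_eq_mul]
    _ ≤ ((n.choose k * n^k : ℕ) : ℝ) * (2^k * ∏ i, q i (σ i)) := by gcongr
    _ = _ := by push_cast; rw [mul_pow]; ring

lemma near_perm {n k : ℕ} (q : Fin n → Fin n → ℝ) (h1 : ∀ i j, 1 ≤ q i j) (h2 : ∀ i j, q i j ≤ 2)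
    (hk : k ≤ n) :
    (k.factorial : ℝ) * ∑ g : Fin n → Fin n with n ≤ #(Finset.univ.image g) + k, ∏ i, q i (g i) ≤
      (n.choose k : ℝ) * (2 * n)^k * pm q := by
  classical
  have hq0 : ∀ i j, 0 ≤ q i j := fun i j => by linarith [h1 i j]
  have hP : ∀ g : Fin n → Fin n, 0 ≤ ∏ i, q i (g i) := fun g => Finset.prod_nonneg fun i _ => hq0 _ _
  rw [Finset.mul_sum]
  calc _ ≤ ∑ g : Fin n → Fin n with n ≤ #(Finset.univ.image g) + k,
        ∑ σ : Equiv.Perm (Fin n), if #{i | g i ≠ σ i} ≤ k then ∏ i, q i (g i) else 0 := by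
        refine Finset.sum_le_sum fun g hg => ?_
        rw [← Finset.sum_filter, Finset.sum_const, nsmul_eq_mul]
        refine mul_le_mul_of_nonneg_right ?_ (hP g)
        exact_mod_cast near_count hk g (by simpa using hg)
    _ ≤ ∑ g : Fin n → Fin n,
        ∑ σ : Equiv.Perm (Fin n), if #{i | g i ≠ σ i} ≤ k then ∏ i, q i (g i) else 0 := by
        refine Finset.sum_le_univ_sum_of_nonneg fun g => Finset.sum_nonneg fun σ _ => ?_
        split_ifs
        · exact hP g
        · exact le_rfl
    _ = ∑ σ : Equiv.Perm (Fin n), ∑ g : Fin n → Fin n with #{i | g i ≠ σ i} ≤ k, ∏ i, q i (g i) := by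
        rw [Finset.sum_comm]
        refine Finset.sum_congr rfl fun σ _ => ?_
        rw [Finset.sum_filter]
    _ ≤ ∑ σ : Equiv.Perm (Fin n), (n.choose k : ℝ) * (2 * n)^k * ∏ i, q i (σ i) :=
        Finset.sum_le_sum fun σ _ => near_sum q h1 h2 hk σ
    _ = _ := by rw [← Finset.mul_sum]; rfl

end LT

namespace LT

lemma bip_adj {n : ℕ} (S : Finset (Fin n × Fin n)) (x y : Fin n ⊕ Fin n) :
    (bipGraph S).Adj x y ↔ (∃ p ∈ S, (x = Sum.inl p.1 ∧ y = Sum.inr p.2) ∨ (y = Sum.inl p.1 ∧ x = Sum.inr p.2)) := by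
  unfold bipGraph
  rw [SimpleGraph.fromRel_adj]
  constructor
  · rintro ⟨_, ⟨p, hp, h⟩ | ⟨p, hp, h⟩⟩
    · exact ⟨p, hp, Or.inl h⟩
    · exact ⟨p, hp, Or.inr h⟩
  · rintro ⟨p, hp, ⟨rfl, rfl⟩ | ⟨rfl, rfl⟩⟩
    · exact ⟨by simp, Or.inl ⟨p, hp, rfl, rfl⟩⟩
    · exact ⟨by simp, Or.inr ⟨p, hp, rfl, rfl⟩⟩

lemma bip_card {n : ℕ} (S : Finset (Fin n × Fin n)) (hS : (bipGraph S).IsTree) : #S + 1 = 2 * n := by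
  classical
  have h := hS.card_edgeFinset
  rw [Fintype.card_sum, Fintype.card_fin] at h
  have : (bipGraph S).edgeFinset = S.image (fun p => s(Sum.inl p.1, Sum.inr p.2)) := by
    ext z
    induction z with
    | _ x y =>
      rw [SimpleGraph.mem_edgeFinset, SimpleGraph.mem_edgeSet, bip_adj]
      simp only [Finset.mem_image, Sym2.eq_iff]
      constructor
      · rintro ⟨p, hp, ⟨rfl, rfl⟩ | ⟨rfl, rfl⟩⟩
        · exact ⟨p, hp, by simp⟩
        · exact ⟨p, hp, by simp⟩
      · rintro ⟨p, hp, ⟨rfl, rfl⟩ | ⟨rfl, rfl⟩⟩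
        · exact ⟨p, hp, by simp⟩
        · exact ⟨p, hp, by simp⟩
  rw [this, Finset.card_image_of_injective] at h
  · omega
  · intro p p' hh
    simp only [Sym2.eq_iff] at hh
    simp at hh
    exact Prod.ext hh.1 hh.2

lemma contract_adj {n : ℕ} (π : Equiv.Perm (Fin n)) (S : Finset (Fin n × Fin n)) (i j : Fin n) :
    (contractGraph π S).Adj i j ↔ i ≠ j ∧ ((i, π j) ∈ S ∨ (j, π i) ∈ S) := by
  unfold contractGraph
  rw [SimpleGraph.fromRel_adj]

lemma contract_conn {n : ℕ} (π : Equiv.Perm (Fin n)) (S : Finset (Fin n × Fin n))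
    (hS : (bipGraph S).IsTree) : (contractGraph π S).Preconnected := by
  let f : Fin n ⊕ Fin n → Fin n := Sum.elim id π.symm
  have key : ∀ x y, (bipGraph S).Reachable x y → (contractGraph π S).Reachable (f x) (f y) := by
    rintro x y ⟨w⟩
    induction w with
    | nil => exact SimpleGraph.Reachable.refl _
    | @cons a b c hab w ih =>
      refine SimpleGraph.Reachable.trans ?_ ih
      by_cases h : f a = f b
      · rw [h]
      · refine SimpleGraph.Adj.reachable ?_
        rw [contract_adj]
        refine ⟨h, ?_⟩
        rw [bip_adj] at hab
        obtain ⟨p, hp, ⟨rfl, rfl⟩ | ⟨rfl, rfl⟩⟩ := hab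
        · left; simpa [f] using hp
        · right; simpa [f] using hp
  intro i j
  exact key (Sum.inl i) (Sum.inl j) (hS.connected.preconnected _ _)

/-- the cell attached to a parent pointer -/
def cell {n : ℕ} (π : Equiv.Perm (Fin n)) (g : Fin n → Fin n) (b : Fin n → Bool) (i : Fin n) : Fin n × Fin n :=
  if b i then (i, π (g i)) else (g i, π i)

lemma exists_parent {n : ℕ} (hn : 1 ≤ n) (π : Equiv.Perm (Fin n)) (S : Finset (Fin n × Fin n))
    (hS : (bipGraph S).IsTree) (hM : ∀ i, (i, π i) ∈ S) :
    ∃ (g : Fin n → Fin n) (b : Fin n → Bool),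
      S = (Finset.univ.image fun i => (i, π i)) ∪ Finset.univ.image (cell π g b) ∧
      n ≤ #(Finset.univ.image g) + ({i : Fin n | ((contractGraph π S).neighborSet i).ncard = 1}.ncard) := by
  classical
  have hc := contract_conn π S hS
  set G := contractGraph π S with hG
  let r : Fin n := ⟨0, hn⟩
  have hpar : ∀ i, i ≠ r → ∃ j, G.Adj i j ∧ G.dist j r < G.dist i r := by
    intro i hi
    obtain ⟨w, hw⟩ := (hc i r).exists_walk_length_eq_dist
    cases w with
    | nil => exact absurd rfl hi
    | @cons _ j _ hab w =>
      refine ⟨j, hab, ?_⟩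
      have := SimpleGraph.dist_le w
      simp at hw
      omega
  choose! g0 hg0 using hpar
  let g : Fin n → Fin n := fun i => if i = r then r else g0 i
  have hgr : g r = r := by simp [g]
  have hg : ∀ i, i ≠ r → G.Adj i (g i) ∧ G.dist (g i) r < G.dist i r := by
    intro i hi; simp only [g, if_neg hi]; exact hg0 i hi
  let b : Fin n → Bool := fun i => decide ((i, π (g i)) ∈ S)
  have hcellS : ∀ i, cell π g b i ∈ S := by
    intro i
    unfold cell
    by_cases hb : (i, π (g i)) ∈ S
    · simp [b, hb]
    · simp only [b, hb, decide_false, Bool.false_eq_true, if_false]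
      by_cases hi : i = r
      · subst hi; rw [hgr]; exact hM r
      · have := (hg i hi).1
        rw [hG, contract_adj] at this
        exact this.2.resolve_left hb
  have hne : ∀ i, i ≠ r → g i ≠ i := fun i hi h => by
    have := (hg i hi).2; rw [h] at this; exact lt_irrefl _ this
  have hinjM : Function.Injective fun i : Fin n => (i, π i) := fun i j h => (Prod.ext_iff.1 h).1
  have hinjc : Set.InjOn (cell π g b) ((Finset.univ.erase r : Finset (Fin n)) : Set (Fin n)) := by
    intro i hi j hj h
    have hi' : i ≠ r := by simpa using hi
    have hj' : j ≠ r := by simpa using hj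
    have di := (hg i hi').2
    have dj := (hg j hj').2
    unfold cell at h
    split_ifs at h with h1 h2 h2
    · exact (Prod.ext_iff.1 h).1
    · obtain ⟨h3, h4⟩ := Prod.ext_iff.1 h
      have h4' := π.injective h4
      simp only at h3 h4'
      rw [← h3] at dj; rw [h4'] at di; omega
    · obtain ⟨h3, h4⟩ := Prod.ext_iff.1 h
      have h4' := π.injective h4
      simp only at h3 h4'
      rw [h3] at di; rw [← h4'] at dj; omega
    · exact π.injective (Prod.ext_iff.1 h).2
  have hdisj : Disjoint (Finset.univ.image fun i => (i, π i)) ((Finset.univ.erase r).image (cell π g b)) := by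
    rw [Finset.disjoint_left]
    intro p hp hp'
    simp only [Finset.mem_image, Finset.mem_univ, true_and, Finset.mem_erase, and_true] at hp hp'
    obtain ⟨i, rfl⟩ := hp
    obtain ⟨j, hj, h⟩ := hp'
    unfold cell at h
    split_ifs at h
    · obtain ⟨h3, h4⟩ := Prod.ext_iff.1 h
      have h4' := π.injective h4
      simp only at h3
      exact hne j hj (by rw [h4', h3])
    · obtain ⟨h3, h4⟩ := Prod.ext_iff.1 h
      have h4' := π.injective h4
      simp only at h3
      exact hne j hj (h3.trans h4'.symm)
  have hSeq : (Finset.univ.image fun i => (i, π i)) ∪ (Finset.univ.erase r).image (cell π g b) = S := by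
    apply Finset.eq_of_subset_of_card_le
    · intro p hp
      simp only [Finset.mem_union, Finset.mem_image, Finset.mem_univ, true_and] at hp
      rcases hp with ⟨i, rfl⟩ | ⟨i, _, rfl⟩
      · exact hM i
      · exact hcellS i
    · rw [Finset.card_union_of_disjoint hdisj, Finset.card_image_of_injective _ hinjM, Finset.card_image_of_injOn hinjc,
        Finset.card_erase_of_mem (Finset.mem_univ _), Finset.card_univ, Fintype.card_fin]
      have := bip_card S hS
      omega
  have hSeq' : S = (Finset.univ.image fun i => (i, π i)) ∪ Finset.univ.image (cell π g b) := by
    apply Finset.Subset.antisymm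
    · rw [← hSeq]
      gcongr
      simp
    · intro p hp
      simp only [Finset.mem_union, Finset.mem_image, Finset.mem_univ, true_and] at hp
      rcases hp with ⟨i, rfl⟩ | ⟨i, rfl⟩
      · exact hM i
      · exact hcellS i
  refine ⟨g, b, hSeq', ?_⟩
  -- defect
  have hmem : ∀ i j, i ≠ j → (i, π j) ∈ S → j = g i ∨ i = g j := by
    intro i j hij h
    rw [hSeq'] at h
    simp only [Finset.mem_union, Finset.mem_image, Finset.mem_univ, true_and] at h
    rcases h with ⟨m, h⟩ | ⟨m, h⟩
    · obtain ⟨h3, h4⟩ := Prod.ext_iff.1 h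
      have h4' := π.injective h4
      simp only at h3
      exact absurd (h3.symm.trans h4') hij
    · unfold cell at h
      split_ifs at h
      · obtain ⟨h3, h4⟩ := Prod.ext_iff.1 h
        have h4' := π.injective h4
        simp only at h3
        left; rw [← h4', h3]
      · obtain ⟨h3, h4⟩ := Prod.ext_iff.1 h
        have h4' := π.injective h4
        simp only at h3
        right; rw [← h4', h3]
  have hleaf : ((Finset.univ.image g)ᶜ : Finset (Fin n)) ⊆ Finset.univ.filter fun i : Fin n => (G.neighborSet i).ncard = 1 := by
    intro i hi
    simp only [Finset.mem_compl, Finset.mem_image, Finset.mem_univ, true_and, not_exists, Finset.mem_filter] at hi ⊢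
    have hir : i ≠ r := fun h => hi r (by rw [hgr, h])
    have : G.neighborSet i = {g i} := by
      ext j
      rw [SimpleGraph.mem_neighborSet, Set.mem_singleton_iff]
      constructor
      · intro h
        rw [hG, contract_adj] at h
        rcases h.2 with h2 | h2
        · rcases hmem i j h.1 h2 with h3 | h3
          · exact h3
          · exact absurd h3.symm (hi j)
        · rcases hmem j i h.1.symm h2 with h3 | h3
          · exact absurd h3.symm (hi j)
          · exact h3
      · rintro rfl; exact (hg i hir).1
    rw [this, Set.ncard_singleton]
  have h5 := Finset.card_le_card hleaf
  rw [Finset.card_compl, Fintype.card_fin] at h5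
  have h6 : ({i : Fin n | (G.neighborSet i).ncard = 1} : Set (Fin n)).ncard = #{i : Fin n | (G.neighborSet i).ncard = 1} := by
    rw [← Set.ncard_coe_finset]; congr 1; ext; simp
  rw [h6]; omega

/-- pair weight -/
noncomputable def qe {n : ℕ} (e : Fin (2*n) ≃ Fin n × Bool) (i j : Fin n) : ℝ :=
  (if e.symm (i, false) < e.symm (j, true) then 1 else 0) + (if e.symm (j, false) < e.symm (i, true) then 1 else 0)

lemma qe_le {n : ℕ} (e : Fin (2*n) ≃ Fin n × Bool) (i j : Fin n) : qe e i j ≤ 2 := by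
  unfold qe; split_ifs <;> norm_num

lemma qe_ge {n : ℕ} (e : Fin (2*n) ≃ Fin n × Bool) (he : Valid e) (i j : Fin n) : 1 ≤ qe e i j := by
  unfold qe
  have h1 := he i
  have h2 := he j
  split_ifs with h3 h4 h4
  · norm_num
  · norm_num
  · norm_num
  · exact absurd (h2.trans_le ((not_lt.1 h3).trans h1.le)) h4

/-- the trees counted for a given matching and order -/
def TreeOK {n : ℕ} (k : ℕ) (π : Equiv.Perm (Fin n)) (e : Fin (2*n) ≃ Fin n × Bool) (S : Finset (Fin n × Fin n)) : Prop :=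
  (bipGraph S).IsTree ∧ (∀ i, (i, π i) ∈ S) ∧ (∀ i j, (i, π j) ∈ S → e.symm (i, false) < e.symm (j, true)) ∧
    ({i : Fin n | ((contractGraph π S).neighborSet i).ncard = 1}.ncard) ≤ k

open Classical in
lemma tree_count {n : ℕ} (hn : 1 ≤ n) (k : ℕ) (π : Equiv.Perm (Fin n)) (e : Fin (2*n) ≃ Fin n × Bool) :
    (#{S | TreeOK k π e S} : ℝ) ≤ ∑ g : Fin n → Fin n with n ≤ #(Finset.univ.image g) + k, ∏ i, qe e i (g i) := by
  have hex : ∀ S, TreeOK k π e S → ∃ gb : (_ : Fin n → Fin n) × (Fin n → Bool),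
      S = (Finset.univ.image fun i => (i, π i)) ∪ Finset.univ.image (cell π gb.1 gb.2) ∧
      n ≤ #(Finset.univ.image gb.1) + k := by
    intro S hS
    obtain ⟨g, b, h1, h2⟩ := exists_parent hn π S hS.1 hS.2.1
    exact ⟨⟨g, b⟩, h1, h2.trans (Nat.add_le_add_left hS.2.2.2 _)⟩
  have : Nonempty ((_ : Fin n → Fin n) × (Fin n → Bool)) := ⟨⟨id, fun _ => true⟩⟩
  choose! F hF using hex
  let ok : (Fin n → Fin n) → Fin n → Finset Bool := fun g i =>
    Finset.univ.filter fun b => if b then e.symm (i, false) < e.symm (g i, true) else e.symm (g i, false) < e.symm (i, true)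
  have hle : #{S | TreeOK k π e S} ≤ #((Finset.univ.filter fun g : Fin n → Fin n => n ≤ #(Finset.univ.image g) + k).sigma
      fun g => Fintype.piFinset (ok g)) := by
    apply Finset.card_le_card_of_injOn F
    · intro S hS
      simp only [Finset.coe_filter, Finset.mem_univ, true_and, Set.mem_ofPred_eq] at hS
      obtain ⟨h1, h2⟩ := hF S hS
      simp only [Finset.mem_coe, Finset.mem_sigma, Finset.mem_filter, Finset.mem_univ, true_and, Fintype.mem_piFinset]
      refine ⟨h2, fun i => ?_⟩
      have hcell : cell π (F S).1 (F S).2 i ∈ S := by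
        rw [h1]
        apply Finset.mem_union_right
        rw [← h1]
        exact Finset.mem_image_of_mem _ (Finset.mem_univ i)
      simp only [ok, Finset.mem_filter, Finset.mem_univ, true_and]
      unfold cell at hcell
      split_ifs at hcell ⊢ with hb
      · exact hS.2.2.1 _ _ hcell
      · exact hS.2.2.1 _ _ hcell
    · intro S hS S' hS' h
      simp only [Finset.coe_filter, Finset.mem_univ, true_and, Set.mem_ofPred_eq] at hS hS'
      rw [(hF S hS).1, (hF S' hS').1, h]
  have hle' : (#{S | TreeOK k π e S} : ℝ) ≤ #((Finset.univ.filter fun g : Fin n → Fin n => n ≤ #(Finset.univ.image g) + k).sigma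
      fun g => Fintype.piFinset (ok g)) := by exact_mod_cast hle
  refine hle'.trans (le_of_eq ?_)
  rw [Finset.card_sigma]
  push_cast
  refine Finset.sum_congr rfl fun g _ => ?_
  rw [Fintype.card_piFinset]
  push_cast
  refine Finset.prod_congr rfl fun i _ => ?_
  simp only [ok, qe]
  rw [Finset.card_filter, Fintype.sum_bool]
  push_cast
  simp only [if_true, Bool.false_eq_true, if_false]

lemma qe_sum {n : ℕ} (e : Fin (2*n) ≃ Fin n × Bool) :
    ∑ i, ∑ j, qe e i j = 2 * ∑ j, (arow e (e.symm (j, true)) : ℝ) := by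
  have h : ∑ i, ∑ j, (if e.symm (i, false) < e.symm (j, true) then (1:ℝ) else 0) = ∑ j, (arow e (e.symm (j, true)) : ℝ) := by
    rw [Finset.sum_comm]
    refine Finset.sum_congr rfl fun j _ => ?_
    unfold arow
    rw [Finset.card_filter]
    push_cast
    rfl
  unfold qe
  simp only [Finset.sum_add_distrib]
  rw [h, Finset.sum_comm, h]; ring

lemma qe_exp {n : ℕ} (e : Fin (2*n) ≃ Fin n × Bool) :
    Real.exp ((∑ i, ∑ j, qe e i j) / (2 * n)) = ∏ t, (if (e t).2 = true then Real.exp ((arow e t : ℝ) / n) else 1) := by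
  rw [qe_sum, ← e.symm.prod_comp, Fintype.prod_prod_type]
  simp [Real.exp_sum, Finset.sum_div, mul_div_mul_left]

end LT

namespace LT

lemma exp_int_bound (m : ℕ) :
    ∫ x : ℝ, (Set.Icc (0:ℝ) 1).indicator (fun x => Real.exp (-(m * x))) x ≤ 1 / max 1 (m:ℝ) := by
  rw [integral_indicator measurableSet_Icc, integral_Icc_eq_integral_Ioc, ← intervalIntegral.integral_of_le (by norm_num)]
  rcases Nat.eq_zero_or_pos m with h | h
  · subst h; simp
  · have hm : (1:ℝ) ≤ m := by exact_mod_cast h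
    rw [max_eq_right hm]
    have hm0 : (m:ℝ) ≠ 0 := by positivity
    have : ∫ x in (0:ℝ)..1, Real.exp (-(m * x)) = (1 - Real.exp (-m)) / m := by
      have h1 : ∀ x ∈ Set.uIcc (0:ℝ) 1, HasDerivAt (fun x => -Real.exp (-(m * x)) / m) (Real.exp (-(m * x))) x := by
        intro x _
        have h2 : HasDerivAt (fun x : ℝ => -(m * x)) (-(m:ℝ)) x := by
          have := ((hasDerivAt_id x).const_mul (m:ℝ)).neg
          rw [mul_one] at this
          exact this
        have h3 := (h2.exp.neg).div_const (m:ℝ)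
        have e : -(Real.exp (-(m * x)) * -(m:ℝ)) / m = Real.exp (-(m * x)) := by field_simp
        rw [e] at h3
        exact h3
      rw [intervalIntegral.integral_eq_sub_of_hasDerivAt h1 (Continuous.intervalIntegrable (by fun_prop) _ _)]
      simp; field_simp; ring
    rw [this]
    gcongr
    linarith [Real.exp_pos (-(m:ℝ))]

lemma exp_integrable (m : ℕ) :
    Integrable (fun x : ℝ => (Set.Icc (0:ℝ) 1).indicator (fun x => Real.exp (-(m * x))) x) := by
  rw [integrable_indicator_iff measurableSet_Icc]
  exact ContinuousOn.integrableOn_Icc (by fun_prop)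

open Classical in
lemma vol_box {I : Type*} [Fintype I] (P : I → Prop) (cr : {q // ¬ P q} → {q // P q} → Prop) :
    volume {z : I → ℝ | (∀ q, 0 ≤ z q ∧ z q ≤ 1) ∧
      ∀ p : {q // ¬ P q}, ∑ q : {q // P q}, (if cr p q then z q else 0) ≤ z p} ≤
    ENNReal.ofReal (∏ q : {q // P q}, 1 / max 1 ((#{p | cr p q} : ℕ) : ℝ)) := by
  set m : {q // P q} → ℕ := fun q => #{p | cr p q} with hm
  set B : Set (({q // P q} → ℝ) × ({q // ¬ P q} → ℝ)) :=
    {w | (∀ q, 0 ≤ w.1 q ∧ w.1 q ≤ 1) ∧ (∀ p, 0 ≤ w.2 p ∧ w.2 p ≤ 1) ∧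
      ∀ p, ∑ q, (if cr p q then w.1 q else 0) ≤ w.2 p} with hB
  have hBm : MeasurableSet B := by
    have : IsClosed B := by
      rw [hB]
      simp only [Set.ofPred_and, Set.ofPred_forall]
      refine IsClosed.inter ?_ (IsClosed.inter ?_ ?_)
      · exact isClosed_iInter fun q => (isClosed_le (by fun_prop) (by fun_prop)).inter (isClosed_le (by fun_prop) (by fun_prop))
      · exact isClosed_iInter fun q => (isClosed_le (by fun_prop) (by fun_prop)).inter (isClosed_le (by fun_prop) (by fun_prop))
      · refine isClosed_iInter fun p => isClosed_le ?_ (by fun_prop)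
        refine continuous_finsetSum _ fun q _ => ?_
        split_ifs <;> fun_prop
    exact this.measurableSet
  have hmp := volume_preserving_piEquivPiSubtypeProd (fun _ : I => ℝ) P
  have hpre : {z : I → ℝ | (∀ q, 0 ≤ z q ∧ z q ≤ 1) ∧
      ∀ p : {q // ¬ P q}, ∑ q : {q // P q}, (if cr p q then z q else 0) ≤ z p} ⊆
      (MeasurableEquiv.piEquivPiSubtypeProd (fun _ : I => ℝ) P) ⁻¹' B := by
    rintro z ⟨h1, h2⟩
    exact ⟨fun q => h1 q, fun p => h1 p, h2⟩
  refine (measure_mono hpre).trans ?_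
  rw [hmp.measure_preimage hBm.nullMeasurableSet]
  rw [Measure.volume_eq_prod, Measure.prod_apply hBm]
  have hslice : ∀ x : {q // P q} → ℝ, volume (Prod.mk x ⁻¹' B) ≤
      ENNReal.ofReal (∏ q, (Set.Icc (0:ℝ) 1).indicator (fun x => Real.exp (-(m q * x))) (x q)) := by
    intro x
    by_cases hx : ∀ q, 0 ≤ x q ∧ x q ≤ 1
    · have hsub : Prod.mk x ⁻¹' B ⊆ Set.pi Set.univ fun p => Set.Icc (∑ q, (if cr p q then x q else 0)) 1 := by
        intro y hy p _
        exact ⟨hy.2.2 p, (hy.2.1 p).2⟩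
      refine (measure_mono hsub).trans ?_
      rw [volume_pi_pi]
      calc _ ≤ ∏ p : {q // ¬ P q}, ENNReal.ofReal (Real.exp (-(∑ q, (if cr p q then x q else 0)))) := by
            refine Finset.prod_le_prod' fun p _ => ?_
            rw [Real.volume_Icc]
            apply ENNReal.ofReal_le_ofReal
            have := Real.add_one_le_exp (-(∑ q, (if cr p q then x q else 0)))
            linarith
        _ = ENNReal.ofReal (Real.exp (-∑ p : {q // ¬ P q}, (∑ q, (if cr p q then x q else 0)))) := by
            rw [← ENNReal.ofReal_prod_of_nonneg (fun _ _ => (Real.exp_pos _).le), ← Real.exp_sum, Finset.sum_neg_distrib]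
        _ = _ := by
            congr 1
            rw [Finset.sum_comm, ← Finset.sum_neg_distrib, Real.exp_sum]
            refine Finset.prod_congr rfl fun q _ => ?_
            rw [Set.indicator_of_mem (show x q ∈ Set.Icc (0:ℝ) 1 from hx q)]
            congr 2
            rw [← Finset.sum_filter, Finset.sum_const, nsmul_eq_mul]
    · have : Prod.mk x ⁻¹' B = ∅ := by
        ext y; simp only [Set.mem_preimage, Set.mem_empty_iff_false, iff_false]
        intro hy; exact hx hy.1
      rw [this]; simp
  refine (lintegral_mono hslice).trans ?_
  rw [← ofReal_integral_eq_lintegral_ofReal]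
  · apply ENNReal.ofReal_le_ofReal
    rw [integral_fintype_prod_volume_eq_prod (fun q => (Set.Icc (0:ℝ) 1).indicator (fun x => Real.exp (-(m q * x))))]
    refine Finset.prod_le_prod (fun q _ => ?_) fun q _ => exp_int_bound (m q)
    exact integral_nonneg fun x => Set.indicator_nonneg (fun _ _ => (Real.exp_pos _).le) _
  · exact Integrable.fintype_prod (f := fun q => (Set.Icc (0:ℝ) 1).indicator (fun x => Real.exp (-(m q * x)))) fun q => exp_integrable (m q)
  · exact Filter.Eventually.of_forall fun x => Finset.prod_nonneg fun q _ => Set.indicator_nonneg (fun _ _ => (Real.exp_pos _).le) _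

end LT

namespace LT

lemma pot_const {n : ℕ} {R : Type*} (S : Finset (Fin n × Fin n)) (hS : (bipGraph S).Connected)
    (r s : Fin n → ℕ) (hsurj : ∀ k < 2*n, (∃ i, r i = k) ∨ (∃ j, s j = k))
    (F : ℕ → R) (hF : ∀ p ∈ S, F (r p.1) = F (s p.2)) (k l : ℕ) (hk : k < 2*n) (hl : l < 2*n) : F k = F l := by
  let f : Fin n ⊕ Fin n → R := Sum.elim (fun i => F (r i)) (fun j => F (s j))
  have hw : ∀ x y, (bipGraph S).Walk x y → f x = f y := by
    intro x y w
    induction w with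
    | nil => rfl
    | cons h _ ih =>
      rw [← ih]
      rw [bip_adj] at h
      obtain ⟨p, hp, ⟨h1, h2⟩ | ⟨h1, h2⟩⟩ := h
      · subst h1 h2; exact hF p hp
      · subst h1 h2; exact (hF p hp).symm
  have hx : ∀ k < 2*n, ∃ x, f x = F k := by
    intro k hk
    rcases hsurj k hk with ⟨i, rfl⟩ | ⟨j, rfl⟩
    · exact ⟨Sum.inl i, rfl⟩
    · exact ⟨Sum.inr j, rfl⟩
  obtain ⟨x, hx1⟩ := hx k hk
  obtain ⟨y, hy1⟩ := hx l hl
  obtain ⟨w⟩ := hS.preconnected x y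
  rw [← hx1, ← hy1]; exact hw x y w

/-- The matrix sending gap variables (and off-tree costs) to costs. -/
def gapM {n : ℕ} (R : Type*) [CommRing R] (S : Finset (Fin n × Fin n)) (r s : Fin n → ℕ)
    (κ : Fin n × Fin n → ℕ) : Matrix (Fin n × Fin n) (Fin n × Fin n) R :=
  fun p q => if p ∈ S then (if q ∈ S ∧ r p.1 ≤ κ q ∧ κ q < s p.2 then 1 else 0) else (if p = q then 1 else 0)

lemma gapM_mulVec {n : ℕ} (R : Type*) [CommRing R] (S : Finset (Fin n × Fin n)) (r s : Fin n → ℕ)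
    (κ : Fin n × Fin n → ℕ) (z : Fin n × Fin n → R) (p : Fin n × Fin n) :
    (gapM R S r s κ).mulVec z p = if p ∈ S then ∑ q ∈ S with r p.1 ≤ κ q ∧ κ q < s p.2, z q else z p := by
  unfold Matrix.mulVec dotProduct gapM
  by_cases h : p ∈ S
  · simp only [if_pos h, ite_mul, one_mul, zero_mul]
    rw [← Finset.sum_filter]
    congr 1
    ext q; simp
  · simp [h]

lemma gapM_inj {n : ℕ} (R : Type*) [CommRing R] (S : Finset (Fin n × Fin n)) (hS : (bipGraph S).Connected)
    (r s : Fin n → ℕ) (hsurj : ∀ k < 2*n, (∃ i, r i = k) ∨ (∃ j, s j = k))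
    (hord : ∀ p ∈ S, r p.1 < s p.2)
    (κ : Fin n × Fin n → ℕ) (hκ : Set.InjOn κ S) (hκ2 : ∀ q ∈ S, κ q + 1 < 2*n)
    (z : Fin n × Fin n → R) (hz : (gapM R S r s κ).mulVec z = 0) : z = 0 := by
  have h1 := fun p => congrFun hz p
  simp only [gapM_mulVec, Pi.zero_apply] at h1
  let F : ℕ → R := fun k => ∑ q ∈ S with κ q < k, z q
  have hdiff : ∀ a b, a ≤ b → F b = F a + ∑ q ∈ S with a ≤ κ q ∧ κ q < b, z q := by
    intro a b hab
    simp only [F]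
    rw [← Finset.sum_union]
    · apply Finset.sum_congr _ fun _ _ => rfl
      ext q; simp only [mem_filter, mem_union]; grind
    · rw [Finset.disjoint_left]; intro q; simp only [mem_filter]; grind
  have hF : ∀ p ∈ S, F (r p.1) = F (s p.2) := by
    intro p hp
    have := h1 p
    rw [if_pos hp] at this
    rw [hdiff _ _ (hord p hp).le, this, add_zero]
  funext q
  by_cases hq : q ∈ S
  · have h2 := pot_const S hS r s hsurj F hF (κ q) (κ q + 1) (by have := hκ2 q hq; omega) (hκ2 q hq)
    rw [hdiff (κ q) (κ q + 1) (by omega)] at h2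
    have h3 : (S.filter fun q' => κ q ≤ κ q' ∧ κ q' < κ q + 1) = {q} := by
      ext q'; simp only [mem_filter, mem_singleton]
      constructor
      · rintro ⟨h, h'⟩; exact hκ h hq (by omega)
      · rintro rfl; exact ⟨hq, by omega⟩
    rw [h3, Finset.sum_singleton] at h2
    simpa using h2.symm
  · have := h1 q
    rwa [if_neg hq] at this

lemma gapM_det {n : ℕ} (S : Finset (Fin n × Fin n)) (hS : (bipGraph S).Connected)
    (r s : Fin n → ℕ) (hsurj : ∀ k < 2*n, (∃ i, r i = k) ∨ (∃ j, s j = k))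
    (hord : ∀ p ∈ S, r p.1 < s p.2)
    (κ : Fin n × Fin n → ℕ) (hκ : Set.InjOn κ S) (hκ2 : ∀ q ∈ S, κ q + 1 < 2*n) :
    |(gapM ℝ S r s κ).det| = 1 := by
  have hmap : ∀ (R : Type) [CommRing R], gapM R S r s κ = (Int.castRingHom R).mapMatrix (gapM ℤ S r s κ) := by
    intro R _
    ext p q
    simp only [gapM, RingHom.mapMatrix_apply, Matrix.map_apply]
    split_ifs <;> simp
  have hD : (gapM ℤ S r s κ).det.natAbs = 1 := by
    by_contra hne
    obtain ⟨ℓ, hℓ, hdvd⟩ := Nat.exists_prime_and_dvd hne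
    have : Fact ℓ.Prime := ⟨hℓ⟩
    have h0 : (gapM (ZMod ℓ) S r s κ).det = 0 := by
      rw [hmap, ← RingHom.map_det]
      simp only [eq_intCast]
      rw [ZMod.intCast_zmod_eq_zero_iff_dvd]
      exact Int.natCast_dvd.mpr hdvd
    obtain ⟨v, hv, hv2⟩ := Matrix.exists_mulVec_eq_zero_iff.mpr h0
    exact hv (gapM_inj (ZMod ℓ) S hS r s hsurj hord κ hκ hκ2 v hv2)
  rw [hmap, ← RingHom.map_det]
  simp only [eq_intCast]
  rw [← Int.cast_abs, Int.abs_eq_natAbs, hD]; simp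

/-- The event that the tree `S` is optimal with dual order given by `r`, `s`. -/
def EvS {n : ℕ} (S : Finset (Fin n × Fin n)) (r s : Fin n → ℕ) : Set (Fin n × Fin n → ℝ) :=
  {C | (∀ p, 0 ≤ C p ∧ C p ≤ 1) ∧ ∃ H : ℕ → ℝ, (∀ k, k + 1 < 2*n → H (k+1) ≤ H k) ∧
    (∀ p ∈ S, C p = H (r p.1) - H (s p.2)) ∧ ∀ i j, i ≠ j → H (r i) - H (s j) ≤ C (i, j)}

lemma sum_gap {n : ℕ} (S : Finset (Fin n × Fin n)) (κ : Fin n × Fin n → ℕ)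
    (hκ : Set.BijOn κ S (Set.Iio (2*n-1))) (H : ℕ → ℝ) (a b : ℕ) (hab : a ≤ b) (hb : b < 2*n) :
    ∑ q ∈ S with a ≤ κ q ∧ κ q < b, (H (κ q) - H (κ q + 1)) = H a - H b := by
  have h1 : ∑ q ∈ S with a ≤ κ q ∧ κ q < b, (H (κ q) - H (κ q + 1)) = ∑ k ∈ Finset.Ico a b, (H k - H (k+1)) := by
    refine Finset.sum_nbij κ ?_ ?_ ?_ (fun _ _ => rfl)
    · intro q hq; simp only [mem_filter] at hq; simp [hq.2]
    · intro q hq q' hq' h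
      simp only [coe_filter, Set.mem_ofPred_eq] at hq hq'
      exact hκ.injOn hq.1 hq'.1 h
    · intro k hk
      simp only [coe_Ico, Set.mem_Ico] at hk
      obtain ⟨q, hq, rfl⟩ := hκ.surjOn (show k ∈ Set.Iio (2*n-1) by simp only [Set.mem_Iio]; omega)
      exact ⟨q, by simp only [coe_filter, Set.mem_ofPred_eq]; exact ⟨hq, hk⟩, rfl⟩
  rw [h1]
  have := Finset.sum_Ico_sub (fun k => - H k) hab
  simp only [neg_sub_neg] at this
  linarith

open Classical in
lemma vol_Ev_aux {n : ℕ} (S : Finset (Fin n × Fin n)) (hS : (bipGraph S).Connected)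
    (r s : Fin n → ℕ) (hr : ∀ i, r i < 2*n) (hs : ∀ i, s i < 2*n)
    (hsurj : ∀ k < 2*n, (∃ i, r i = k) ∨ (∃ j, s j = k))
    (hord : ∀ p ∈ S, r p.1 < s p.2)
    (κ : Fin n × Fin n → ℕ) (hκ : Set.BijOn κ S (Set.Iio (2*n-1))) :
    volume (EvS S r s) ≤ ENNReal.ofReal (∏ q : {q // q ∈ S},
      1 / max 1 ((#{p : {p // p ∉ S} | p.1.1 ≠ p.1.2 ∧ r p.1.1 ≤ κ q ∧ κ q < s p.1.2} : ℕ) : ℝ)) := by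
  have hκ2 : ∀ q ∈ S, κ q + 1 < 2*n := by
    intro q hq
    have := hκ.mapsTo hq
    simp only [Set.mem_Iio] at this; omega
  have hbox := vol_box (fun q : Fin n × Fin n => q ∈ S) (fun p q => p.1.1 ≠ p.1.2 ∧ r p.1.1 ≤ κ q ∧ κ q < s p.1.2)
  refine le_trans ?_ (hbox.trans (le_of_eq (by congr!)))
  have himg := Measure.addHaar_image_linearMap (volume : Measure (Fin n × Fin n → ℝ)) (Matrix.toLin' (gapM ℝ S r s κ))
  have hdet := gapM_det S hS r s hsurj hord κ hκ.injOn hκ2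
  have hkey : ∀ B : Set (Fin n × Fin n → ℝ), EvS S r s ⊆ Set.image (Matrix.toLin' (gapM ℝ S r s κ)) B →
      volume (EvS S r s) ≤ volume B := by
    intro B hB
    refine (measure_mono hB).trans (le_of_eq ?_)
    rw [himg, LinearMap.det_toLin', hdet]; simp
  apply hkey
  rintro C ⟨hC, H, hH, hCS, hoff⟩
  have hanti : ∀ a b, a ≤ b → b < 2*n → H b ≤ H a := by
    intro a b hab
    induction b, hab using Nat.le_induction with
    | base => intro _; exact le_rfl
    | succ m hm ih => intro h; exact (hH m h).trans (ih (by omega))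
  refine ⟨fun q => if q ∈ S then H (κ q) - H (κ q + 1) else C q, ⟨?_, ?_⟩, ?_⟩
  · intro q
    by_cases hq : q ∈ S
    · simp only [if_pos hq]
      refine ⟨sub_nonneg.mpr (hH _ (hκ2 q hq)), ?_⟩
      have : ∃ p ∈ S, r p.1 ≤ κ q ∧ κ q < s p.2 := by
        by_contra hno
        push Not at hno
        have := pot_const S hS r s hsurj (fun k => decide (k ≤ κ q)) (by
          intro p hp
          have h1 := hno p hp
          have h2 := hord p hp
          by_cases h : r p.1 ≤ κ q
          · have := h1 h; simp [h, this]
          · have : ¬ s p.2 ≤ κ q := by omega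
            simp [h, this]) (κ q) (κ q + 1) (by have := hκ2 q hq; omega) (hκ2 q hq)
        simp at this
      obtain ⟨p, hp, h1, h2⟩ := this
      have h3 := hanti _ _ h1 (by have := hκ2 q hq; omega)
      have h4 := hanti (κ q + 1) _ h2 (hs _)
      have h5 := hCS p hp
      have h6 := (hC p).2
      linarith
    · simp only [if_neg hq]; exact hC q
  · rintro ⟨p, hp⟩
    simp only [if_neg hp]
    by_cases hpp : p.1 ≠ p.2 ∧ r p.1 ≤ s p.2
    · have h1 := sum_gap S κ hκ H (r p.1) (s p.2) hpp.2 (hs _)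
      have h2 := hoff p.1 p.2 hpp.1
      rw [← h1] at h2
      refine le_trans (le_of_eq ?_) h2
      rw [Finset.sum_filter, ← Finset.sum_coe_sort S]
      refine Finset.sum_congr (by congr!) fun q _ => ?_
      simp only [q.2, if_true]
      congr 1
      simp [hpp.1]
    · refine le_trans (le_of_eq (Finset.sum_eq_zero fun q _ => ?_)) (hC p).1
      rw [if_neg]
      rintro ⟨h1, h2, h3⟩
      exact hpp ⟨h1, by omega⟩
  · funext p
    rw [Matrix.toLin'_apply, gapM_mulVec]
    by_cases hp : p ∈ S
    · rw [if_pos hp, hCS p hp, ← sum_gap S κ hκ H (r p.1) (s p.2) (hord p hp).le (hs _)]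
      refine Finset.sum_congr rfl fun q hq => ?_
      rw [if_pos (Finset.mem_filter.mp hq).1]
    · rw [if_neg hp, if_neg hp]

lemma vol_Ev {n : ℕ} (S : Finset (Fin n × Fin n)) (hS : (bipGraph S).IsTree)
    (r s : Fin n → ℕ) (hr : ∀ i, r i < 2*n) (hs : ∀ i, s i < 2*n)
    (hsurj : ∀ k < 2*n, (∃ i, r i = k) ∨ (∃ j, s j = k))
    (hord : ∀ p ∈ S, r p.1 < s p.2) :
    volume (EvS S r s) ≤ ENNReal.ofReal (∏ k ∈ range (2*n-1),
      1 / max 1 ((#{i | r i ≤ k} : ℝ) * (#{j | k < s j} : ℝ) - 3 * n)) := by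
  classical
  have hcard := bip_card S hS
  obtain ⟨κ, hκ⟩ : ∃ κ : Fin n × Fin n → ℕ, Set.BijOn κ S (Set.Iio (2*n-1)) := by
    have h : (S : Set (Fin n × Fin n)).encard = (Set.Iio (2*n-1)).encard := by
      have h2 : (Set.Iio (2*n-1)) = ((range (2*n-1) : Finset ℕ) : Set ℕ) := by ext; simp
      rw [h2, Set.encard_coe_eq_coe_finsetCard, Set.encard_coe_eq_coe_finsetCard, card_range]
      congr 1; omega
    exact (Finset.finite_toSet S).exists_bijOn_of_encard_eq h
  refine (vol_Ev_aux S hS.connected r s hr hs hsurj hord κ hκ).trans (ENNReal.ofReal_le_ofReal ?_)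
  have hre : ∏ k ∈ range (2*n-1), 1 / max 1 ((#{i | r i ≤ k} : ℝ) * (#{j | k < s j} : ℝ) - 3 * n)
      = ∏ q ∈ S, 1 / max 1 ((#{i | r i ≤ κ q} : ℝ) * (#{j | κ q < s j} : ℝ) - 3 * n) := by
    symm
    refine Finset.prod_nbij κ ?_ hκ.injOn ?_ (fun _ _ => rfl)
    · intro q hq; have := hκ.mapsTo hq; simpa using this
    · have : ((range (2*n-1) : Finset ℕ) : Set ℕ) = (Set.Iio (2*n-1)) := by ext; simp
      rw [this]; exact hκ.surjOn
  rw [hre, ← Finset.prod_coe_sort S]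
  refine Finset.prod_le_prod (fun q _ => by positivity) fun q _ => ?_
  apply one_div_le_one_div_of_le (by positivity)
  apply max_le_max le_rfl
  set F : Finset {p // p ∉ S} := {p : {p // p ∉ S} | p.1.1 ≠ p.1.2 ∧ r p.1.1 ≤ κ q ∧ κ q < s p.1.2} with hF
  have hsub : (univ.filter fun i => r i ≤ κ q) ×ˢ (univ.filter fun j => κ q < s j) ⊆
      F.image Subtype.val ∪ (S ∪ univ.image (fun i : Fin n => (i, i))) := by
    intro p hp
    simp only [mem_product, mem_filter, mem_univ, true_and] at hp
    simp only [mem_union, mem_image, mem_univ, true_and]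
    by_cases h1 : p ∈ S
    · exact Or.inr (Or.inl h1)
    by_cases h2 : p.1 = p.2
    · exact Or.inr (Or.inr ⟨p.1, Prod.ext rfl h2⟩)
    · refine Or.inl ⟨⟨p, h1⟩, ?_, rfl⟩
      simp only [hF, mem_filter, mem_univ, true_and]
      exact ⟨h2, hp⟩
  have h1 := card_le_card hsub
  rw [card_product] at h1
  have h2 := card_union_le (F.image Subtype.val) (S ∪ univ.image (fun i : Fin n => (i, i)))
  have h3 := card_union_le S (univ.image (fun i : Fin n => (i, i)))
  have h4 : #(F.image Subtype.val) ≤ #F := card_image_le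
  have h5 : #(univ.image (fun i : Fin n => (i, i))) ≤ n := card_image_le.trans (by simp)
  have h6 : #{i | r i ≤ κ q} * #{j | κ q < s j} ≤ #F + 3 * n := by omega
  have h7 : (#{i | r i ≤ κ q} : ℝ) * #{j | κ q < s j} ≤ #F + 3 * n := by exact_mod_cast h6
  linarith

end LT

namespace LT

lemma arow_add_dcol {n : ℕ} (e : Fin (2*n) ≃ Fin n × Bool) (t : ℕ) (ht : t ≤ 2*n) :
    arow e t + dcol e t = t := by
  have h1 : #{x : Fin (2*n) | x.val < t} = t := by
    rw [Fin.card_filter_val_lt]; omega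
  have h2 : #{x : Fin (2*n) | x.val < t} = arow e t + dcol e t := by
    rw [arow, dcol, card_filter, card_filter, card_filter, ← Equiv.sum_comp e.symm, Fintype.sum_prod_type]
    simp only [Fintype.sum_bool, sum_add_distrib]
    rw [add_comm]
  omega

lemma dcol_le_arow {n : ℕ} (e : Fin (2*n) ≃ Fin n × Bool) (he : Valid e) (t : ℕ) : dcol e t ≤ arow e t := by
  apply card_le_card
  intro i
  simp only [mem_filter, mem_univ, true_and]
  intro h
  have : (e.symm (i, false)).val < (e.symm (i, true)).val := he i
  omega

lemma arow_le {n : ℕ} (e : Fin (2*n) ≃ Fin n × Bool) (t : ℕ) : arow e t ≤ n := by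
  exact (card_le_univ _).trans (by simp)

lemma ab_ge {n : ℕ} (e : Fin (2*n) ≃ Fin n × Bool) (he : Valid e) (t : ℕ) (ht : t ≤ 2*n) :
    (t:ℝ) * (2*n - t) / 4 ≤ (arow e t : ℝ) * ((n:ℝ) - dcol e t) := by
  have h1 : (arow e t : ℝ) + dcol e t = t := by exact_mod_cast arow_add_dcol e t ht
  have h2 : (dcol e t : ℝ) ≤ arow e t := by exact_mod_cast dcol_le_arow e he t
  have h3 : (t:ℝ) ≤ 2 * n := by exact_mod_cast ht
  have h4 : (t:ℝ)/2 ≤ arow e t := by linarith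
  have h5 : (2*n - t:ℝ)/2 ≤ (n:ℝ) - dcol e t := by linarith
  have h6 : (0:ℝ) ≤ t := by positivity
  have := mul_le_mul h4 h5 (by linarith) (by linarith)
  linarith

lemma factor_le {n : ℕ} (e : Fin (2*n) ≃ Fin n × Bool) (he : Valid e) (t : ℕ) (ht0 : 1 ≤ t) (ht : t < 2*n) :
    1 / max 1 ((arow e t : ℝ) * ((n:ℝ) - dcol e t) - 3 * n) ≤
      (1.01 * if (1212 ≤ t ∧ t + 1212 ≤ 2*n) then 1 else (n:ℝ)^2) * (1 / ((arow e t : ℝ) * ((n:ℝ) - dcol e t))) := by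
  have h1 := ab_ge e he t ht.le
  have h0 : (1:ℝ) ≤ t := by exact_mod_cast ht0
  have h2 : (t:ℝ) + 1 ≤ 2*n := by exact_mod_cast ht
  have hpos : 0 < (arow e t : ℝ) * ((n:ℝ) - dcol e t) := by nlinarith
  set x := (arow e t : ℝ) * ((n:ℝ) - dcol e t) with hx
  have hn : (1:ℝ) ≤ n := by linarith
  split_ifs with h
  · have h3 : (1212:ℝ) ≤ t := by exact_mod_cast h.1
    have h4 : (t:ℝ) + 1212 ≤ 2*n := by exact_mod_cast h.2
    have h5 : 303 * (n:ℝ) ≤ x := by nlinarith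
    rw [mul_one, mul_one_div, div_le_div_iff₀ (by positivity) hpos]
    have := le_max_right 1 (x - 3*n)
    nlinarith
  · have h3 : x ≤ (n:ℝ)^2 := by
      have h4 : (arow e t : ℝ) ≤ n := by exact_mod_cast arow_le e t
      have h5 : (n:ℝ) - dcol e t ≤ n := by
        have : (0:ℝ) ≤ dcol e t := by positivity
        linarith
      have h6 : (0:ℝ) ≤ arow e t := by positivity
      rw [hx]; nlinarith
    have h7 : 1 / max 1 (x - 3*n) ≤ 1 := by
      rw [div_le_one (by positivity)]; exact le_max_left _ _
    refine h7.trans ?_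
    rw [mul_one_div, one_le_div hpos]
    nlinarith

lemma card_ends (n : ℕ) : #{k ∈ range (2*n-1) | ¬ (1212 ≤ k+1 ∧ k+1 + 1212 ≤ 2*n)} ≤ 2424 := by
  have hsub : {k ∈ range (2*n-1) | ¬ (1212 ≤ k+1 ∧ k+1 + 1212 ≤ 2*n)} ⊆ range 1212 ∪ Finset.Ico (2*n - 1212) (2*n) := by
    intro k
    simp only [mem_filter, mem_range, mem_union, Finset.mem_Ico]
    omega
  have h1 := card_le_card hsub
  have h2 := card_union_le (range 1212) (Finset.Ico (2*n - 1212) (2*n))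
  rw [card_range, Nat.card_Ico] at h2
  omega

lemma prod_factor_le {n : ℕ} (hn : 1 ≤ n) (e : Fin (2*n) ≃ Fin n × Bool) (he : Valid e) :
    ∏ k ∈ range (2*n-1), 1 / max 1 ((arow e (k+1) : ℝ) * ((n:ℝ) - dcol e (k+1)) - 3 * n) ≤
      (1.01:ℝ)^(2*n) * (n:ℝ)^4848 * ∏ k ∈ range (2*n-1), 1 / ((arow e (k+1) : ℝ) * ((n:ℝ) - dcol e (k+1))) := by
  have hn' : (1:ℝ) ≤ n := by exact_mod_cast hn
  have hpos : ∀ k ∈ range (2*n-1), 0 ≤ 1 / ((arow e (k+1) : ℝ) * ((n:ℝ) - dcol e (k+1))) := by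
    intro k hk
    rw [mem_range] at hk
    have h1 := ab_ge e he (k+1) (by omega)
    have h2 : ((k+1:ℕ):ℝ) ≤ 2*n := by
      have : k+1 ≤ 2*n := by omega
      exact_mod_cast this
    have h3 : (0:ℝ) ≤ ((k+1:ℕ):ℝ) := by positivity
    apply one_div_nonneg.mpr
    nlinarith
  refine (Finset.prod_le_prod (fun k _ => by positivity) fun k hk => factor_le e he (k+1) (by omega) (by
    rw [mem_range] at hk; omega)).trans ?_
  rw [prod_mul_distrib]
  apply mul_le_mul_of_nonneg_right _ (prod_nonneg hpos)
  rw [prod_mul_distrib, prod_const, card_range]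
  apply mul_le_mul
  · exact pow_le_pow_right₀ (by norm_num) (by omega)
  · rw [prod_ite, prod_const, prod_const, one_pow, one_mul, ← pow_mul]
    apply pow_le_pow_right₀ hn'
    have := card_ends n
    omega
  · exact prod_nonneg fun k _ => by positivity
  · positivity

lemma prod_ew {n : ℕ} (hn : 1 ≤ n) (e : Fin (2*n) ≃ Fin n × Bool) :
    ∏ t, ew e t = (∏ k ∈ range (2*n-1), 1 / ((arow e (k+1) : ℝ) * ((n:ℝ) - dcol e (k+1)))) *
      Real.exp ((∑ i, ∑ j, qe e i j) / (2*n)) := by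
  rw [qe_exp]
  simp only [ew]
  rw [prod_mul_distrib]
  congr 1
  rw [Fin.prod_univ_eq_prod_range (fun t => if t = 0 then (1:ℝ) else 1/((arow e t:ℝ)*((n:ℝ)-dcol e t))) (2*n)]
  have : 2*n = (2*n-1)+1 := by omega
  rw [this, prod_range_succ']
  simp

lemma vol_Ev_le {n : ℕ} (hn : 1 ≤ n) (k : ℕ) (π : Equiv.Perm (Fin n)) (e : Fin (2*n) ≃ Fin n × Bool) (he : Valid e)
    (S : Finset (Fin n × Fin n)) (hS : TreeOK k π e S) :
    volume (EvS S (fun i => (e.symm (i, false)).val) (fun j => (e.symm (π.symm j, true)).val)) ≤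
      ENNReal.ofReal ((1.01:ℝ)^(2*n) * (n:ℝ)^4848 *
        ∏ k ∈ range (2*n-1), 1 / ((arow e (k+1) : ℝ) * ((n:ℝ) - dcol e (k+1)))) := by
  obtain ⟨h1, h2, h3, h4⟩ := hS
  refine (vol_Ev S h1 _ _ (fun i => Fin.isLt _) (fun i => Fin.isLt _) ?_ ?_).trans (ENNReal.ofReal_le_ofReal ?_)
  · intro m hm
    rcases hx : e ⟨m, hm⟩ with ⟨i, b⟩
    have hx' : e.symm (i, b) = ⟨m, hm⟩ := by rw [← hx]; simp
    cases b
    · left; exact ⟨i, by simp [hx']⟩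
    · right; exact ⟨π i, by simp [hx']⟩
  · rintro ⟨i, j⟩ hp
    exact h3 i (π.symm j) (by simpa using hp)
  · refine le_trans (le_of_eq (prod_congr rfl fun m hm => ?_)) (prod_factor_le hn e he)
    have ha : #{i : Fin n | (e.symm (i, false)).val ≤ m} = arow e (m+1) := by
      simp only [arow, Nat.lt_succ_iff]
    have hb : #{j : Fin n | m < (e.symm (π.symm j, true)).val} + dcol e (m+1) = n := by
      have hc : dcol e (m+1) = #{j : Fin n | ¬ m < (e.symm (π.symm j, true)).val} := by
        rw [dcol, card_filter, card_filter, ← Equiv.sum_comp π.symm]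
        refine sum_congr rfl fun j _ => ?_
        congr 1
        simp only [not_lt, Nat.lt_succ_iff]
      rw [hc, card_filter_add_card_filter_not]; simp
    have hb' : (#{j : Fin n | m < (e.symm (π.symm j, true)).val} : ℝ) = (n:ℝ) - dcol e (m+1) := by
      have : (#{j : Fin n | m < (e.symm (π.symm j, true)).val} : ℝ) + dcol e (m+1) = n := by exact_mod_cast hb
      linarith
    rw [ha, hb']

end LT

namespace LT

lemma exists_order {n : ℕ} (h : Fin n × Bool → ℝ) : ∃ e : Fin (2*n) ≃ Fin n × Bool,
    (∀ a b, a ≤ b → h (e b) ≤ h (e a)) ∧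
    ∀ i j, h (j, true) ≤ h (i, false) → e.symm (i, false) < e.symm (j, true) := by
  let e0 : Fin (2*n) ≃ Fin n × Bool := (Fintype.equivFinOfCardEq (by simp [mul_comm])).symm
  let f : Fin n × Bool → ℝ ×ₗ Bool := fun x => toLex (-h x, x.2)
  let e : Fin (2*n) ≃ Fin n × Bool := (Tuple.sort (f ∘ e0)).trans e0
  have hm : Monotone (f ∘ e) := Tuple.monotone_sort (f ∘ e0)
  refine ⟨e, ?_, ?_⟩
  · intro a b hab
    have h1 : toLex (-h (e a), (e a).2) ≤ toLex (-h (e b), (e b).2) := hm hab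
    rw [Prod.Lex.toLex_le_toLex] at h1
    rcases h1 with h1 | h1
    · simp only at h1; linarith
    · have := h1.1; simp only at this; linarith
  · intro i j hij
    apply hm.reflect_lt
    simp only [Function.comp_apply, Equiv.apply_symm_apply, f]
    rw [Prod.Lex.toLex_lt_toLex]
    rcases hij.lt_or_eq with h1 | h1
    · left; simp only; linarith
    · right; simp [h1]

lemma cover {n : ℕ} (k : ℕ) (C : Fin n × Fin n → ℝ) (hC : ∀ p, 0 ≤ C p ∧ C p ≤ 1)
    (S : Finset (Fin n × Fin n)) (π : Equiv.Perm (Fin n)) (hT : (bipGraph S).IsTree)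
    (hM : ∀ i, (i, π i) ∈ S) (u v : Fin n → ℝ) (h1 : ∀ p ∈ S, C p = u p.1 + v p.2)
    (h2 : ∀ i j, i ≠ j → u i + v j ≤ C (i, j))
    (hk : {i : Fin n | ((contractGraph π S).neighborSet i).ncard = 1}.ncard ≤ k) :
    ∃ e : Fin (2*n) ≃ Fin n × Bool, Valid e ∧ TreeOK k π e S ∧
      C ∈ EvS S (fun i => (e.symm (i, false)).val) (fun j => (e.symm (π.symm j, true)).val) := by
  let h : Fin n × Bool → ℝ := fun x => if x.2 then - v (π x.1) else u x.1
  obtain ⟨e, he1, he2⟩ := exists_order h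
  have hlt : ∀ i j, (i, π j) ∈ S → e.symm (i, false) < e.symm (j, true) := by
    intro i j hij
    apply he2
    have := h1 _ hij
    have := (hC (i, π j)).1
    simp [h]; linarith
  refine ⟨e, fun i => hlt i i (hM i), ⟨hT, hM, hlt, hk⟩, hC, ?_⟩
  let H : ℕ → ℝ := fun k => if hk : k < 2*n then h (e ⟨k, hk⟩) else 0
  have hH : ∀ a : Fin (2*n), H a.val = h (e a) := by
    intro a; simp [H]
  refine ⟨H, ?_, ?_, ?_⟩
  · intro m hm
    have := he1 ⟨m, by omega⟩ ⟨m+1, hm⟩ (by simp)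
    rwa [← hH, ← hH] at this
  · intro p hp
    rw [hH, hH, h1 p hp]; simp [h]
  · intro i j hij
    have := h2 i j hij
    rw [hH, hH]; simpa [h] using this

open Classical in
lemma union_bound {n : ℕ} (hn : 1 ≤ n) (k : ℕ) (hk : k ≤ n) (Bad : Set (Fin n × Fin n → ℝ))
    (hBad : ∀ C ∈ Bad, (∀ p, 0 ≤ C p ∧ C p ≤ 1) → ∃ (π : Equiv.Perm (Fin n)) (e : Fin (2*n) ≃ Fin n × Bool)
      (S : Finset (Fin n × Fin n)), Valid e ∧ TreeOK k π e S ∧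
      C ∈ EvS S (fun i => (e.symm (i, false)).val) (fun j => (e.symm (π.symm j, true)).val)) :
    costMeasure n Bad ≤ ENNReal.ofReal (n.factorial * (((n.choose k : ℝ) * (2*n)^k / k.factorial) *
      (n.factorial * n * Real.exp 1 * Real.exp (n * (Real.log 2 - 1))) * ((1.01:ℝ)^(2*n) * (n:ℝ)^4848)
        * (n * Hf n 1 0))) := by
  set W := ((n.choose k : ℝ) * (2*n)^k / k.factorial) *
      (n.factorial * n * Real.exp 1 * Real.exp (n * (Real.log 2 - 1))) * ((1.01:ℝ)^(2*n) * (n:ℝ)^4848) with hW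
  have hW0 : 0 ≤ W := by positivity
  have hcm : costMeasure n = volume.restrict (Set.pi Set.univ fun _ : Fin n × Fin n => Set.Icc (0:ℝ) 1) := by
    rw [costMeasure, volume_pi, Measure.restrict_pi_pi]
  rw [hcm, Measure.restrict_apply' (MeasurableSet.univ_pi fun _ => measurableSet_Icc)]
  have hsub : Bad ∩ (Set.pi Set.univ fun _ : Fin n × Fin n => Set.Icc (0:ℝ) 1) ⊆
      ⋃ π ∈ (Finset.univ : Finset (Equiv.Perm (Fin n))), ⋃ e ∈ ({e | Valid e} : Finset (Fin (2*n) ≃ Fin n × Bool)),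
        ⋃ S ∈ ({S | TreeOK k π e S} : Finset (Finset (Fin n × Fin n))),
        EvS S (fun i => (e.symm (i, false)).val) (fun j => (e.symm (π.symm j, true)).val) := by
    rintro C ⟨hC, hc⟩
    obtain ⟨π, e, S, he, hS, hE⟩ := hBad C hC (fun p => hc p trivial)
    simp only [Set.mem_iUnion]
    exact ⟨π, mem_univ _, e, by simpa using he, S, by simpa using hS, hE⟩
  have hstep : ∀ π : Equiv.Perm (Fin n), ∀ e ∈ ({e | Valid e} : Finset (Fin (2*n) ≃ Fin n × Bool)),
      volume (⋃ S ∈ ({S | TreeOK k π e S} : Finset (Finset (Fin n × Fin n))),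
        EvS S (fun i => (e.symm (i, false)).val) (fun j => (e.symm (π.symm j, true)).val)) ≤
      ENNReal.ofReal (W * ∏ t, ew e t) := by
    intro π e he
    have he : Valid e := by simpa using he
    refine (measure_biUnion_finset_le _ _).trans ?_
    refine (sum_le_sum fun S hS => vol_Ev_le hn k π e he S (by simpa using hS)).trans ?_
    rw [sum_const, nsmul_eq_mul, ← ENNReal.ofReal_natCast, ← ENNReal.ofReal_mul (by positivity)]
    apply ENNReal.ofReal_le_ofReal
    set Q := ∏ k ∈ range (2*n-1), 1 / ((arow e (k+1) : ℝ) * ((n:ℝ) - dcol e (k+1))) with hQ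
    have hQ0 : 0 ≤ Q := by
      apply prod_nonneg
      intro m hm
      rw [mem_range] at hm
      have h1 := ab_ge e he (m+1) (by omega)
      have h2 : ((m+1:ℕ):ℝ) ≤ 2*n := by
        have : m+1 ≤ 2*n := by omega
        exact_mod_cast this
      have h3 : (0:ℝ) ≤ ((m+1:ℕ):ℝ) := by positivity
      apply one_div_nonneg.mpr
      nlinarith
    have ht := tree_count hn k π e
    have hp := near_perm (qe e) (qe_ge e he) (qe_le e) hk
    have hpm := pm_le n hn (qe e) (qe_ge e he) (qe_le e)
    rw [prod_ew hn]
    have hkf : (0:ℝ) < k.factorial := by positivity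
    have hcount : (#{S | TreeOK k π e S} : ℝ) ≤ ((n.choose k : ℝ) * (2*n)^k / k.factorial) *
        ((n.factorial * n * Real.exp 1 * Real.exp (n * (Real.log 2 - 1))) * Real.exp ((∑ i, ∑ j, qe e i j) / (2*n))) := by
      refine ht.trans ?_
      rw [div_mul_eq_mul_div, le_div_iff₀ hkf, mul_comm]
      refine hp.trans ?_
      exact mul_le_mul_of_nonneg_left hpm (by positivity)
    calc _ ≤ _ := mul_le_mul_of_nonneg_right hcount (by positivity)
      _ = _ := by rw [hW]; ring
  refine (measure_mono hsub).trans ((measure_biUnion_finset_le _ _).trans ?_)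
  have hπ : ∀ π ∈ (Finset.univ : Finset (Equiv.Perm (Fin n))),
      volume (⋃ e ∈ ({e | Valid e} : Finset (Fin (2*n) ≃ Fin n × Bool)),
        ⋃ S ∈ ({S | TreeOK k π e S} : Finset (Finset (Fin n × Fin n))),
        EvS S (fun i => (e.symm (i, false)).val) (fun j => (e.symm (π.symm j, true)).val)) ≤
      ENNReal.ofReal (W * (n * Hf n 1 0)) := by
    intro π _
    refine (measure_biUnion_finset_le _ _).trans ((sum_le_sum fun e he => hstep π e he).trans ?_)
    rw [← ENNReal.ofReal_sum_of_nonneg]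
    · apply ENNReal.ofReal_le_ofReal
      rw [← mul_sum]
      refine mul_le_mul_of_nonneg_left ?_ hW0
      convert sum_orders n hn
    · intro e he
      have he : Valid e := by simpa using he
      refine mul_nonneg hW0 (prod_nonneg fun t _ => ?_)
      rw [ew_eq e he]; exact wt_nonneg _ _
  refine (sum_le_sum hπ).trans ?_
  rw [sum_const, nsmul_eq_mul, ← ENNReal.ofReal_natCast, ← ENNReal.ofReal_mul (by positivity), card_univ,
    Fintype.card_perm, Fintype.card_fin]

end LT

namespace LT

lemma fact_exp_le (n : ℕ) (hn : 1 ≤ n) : (n.factorial : ℝ) * Real.exp (n * (1 - Real.log n)) ≤ Real.exp 1 * n := by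
  induction n, hn using Nat.le_induction with
  | base => simp
  | succ n hn ih =>
    have hn' : (1:ℝ) ≤ n := by exact_mod_cast hn
    have hlog : (1:ℝ) / (n+1) ≤ Real.log (n+1) - Real.log n := by
      rw [← Real.log_div (by positivity) (by positivity)]
      have := Real.one_sub_inv_le_log_of_pos (show (0:ℝ) < (n+1)/n by positivity)
      refine le_trans (le_of_eq ?_) this
      field_simp; ring
    have h2 : Real.exp (((n+1:ℕ):ℝ) * (1 - Real.log ((n+1:ℕ):ℝ))) ≤ Real.exp (n * (1 - Real.log n)) * (1 / n) := by
      rw [one_div, ← Real.exp_log (show (0:ℝ) < n by positivity), ← Real.exp_neg, ← Real.exp_add, Real.exp_log (by positivity)]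
      apply Real.exp_le_exp.mpr
      push_cast
      have h3 : 1 ≤ ((n:ℝ)+1) * (Real.log (n+1) - Real.log n) := by
        calc (1:ℝ) = (n+1) * (1/(n+1)) := by field_simp
          _ ≤ _ := mul_le_mul_of_nonneg_left hlog (by positivity)
      linarith
    rw [Nat.factorial_succ]
    push_cast at h2 ⊢
    calc ((n:ℝ)+1) * n.factorial * Real.exp ((n+1) * (1 - Real.log (n+1)))
        ≤ ((n:ℝ)+1) * n.factorial * (Real.exp (n * (1 - Real.log n)) * (1 / n)) := by gcongr
      _ = ((n:ℝ)+1) / n * (n.factorial * Real.exp (n * (1 - Real.log n))) := by ring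
      _ ≤ ((n:ℝ)+1) / n * (Real.exp 1 * n) := by gcongr
      _ = _ := by field_simp

lemma choose_part (n : ℕ) (hn : 1 ≤ n) : (n.choose (n/1000) : ℝ) * (2*n)^(n/1000) / (n/1000).factorial ≤
    Real.exp (n * (0.021 * Real.log 2 + 0.002)) := by
  set k := n/1000 with hk
  have h1 : (n.choose k : ℝ) ≤ (n:ℝ)^k / k.factorial := Nat.choose_le_pow_div k n
  have h2 : (n:ℝ)^k / k.factorial ≤ 1000^k * Real.exp (0.001 * n) := by
    have := Real.pow_div_factorial_le_exp (0.001 * (n:ℝ)) (by positivity) k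
    calc (n:ℝ)^k / k.factorial = 1000^k * ((0.001 * (n:ℝ))^k / k.factorial) := by
          rw [← mul_div_assoc, ← mul_pow]; congr 2; ring
      _ ≤ _ := by gcongr
  have hk' : (k:ℝ) ≤ 0.001 * n := by
    have : 1000 * k ≤ n := by omega
    have : (1000:ℝ) * k ≤ n := by exact_mod_cast this
    linarith
  calc (n.choose k : ℝ) * (2*n)^k / k.factorial ≤ ((n:ℝ)^k / k.factorial) * (2*n)^k / k.factorial := by gcongr
    _ = 2^k * ((n:ℝ)^k / k.factorial) * ((n:ℝ)^k / k.factorial) := by rw [mul_pow]; ring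
    _ ≤ 2^k * (1000^k * Real.exp (0.001 * n)) * (1000^k * Real.exp (0.001 * n)) := by gcongr
    _ = (2000000:ℝ)^k * Real.exp (0.002 * n) := by
        rw [show (0.002:ℝ) * n = 0.001 * n + 0.001 * n by ring, Real.exp_add,
          show (2000000:ℝ) = 2 * 1000 * 1000 by norm_num, mul_pow, mul_pow]; ring
    _ ≤ ((2:ℝ)^21)^k * Real.exp (0.002 * n) := by gcongr; norm_num
    _ = Real.exp (k * (21 * Real.log 2)) * Real.exp (0.002 * n) := by
        congr 1
        rw [Real.exp_nat_mul, mul_comm, ← Real.rpow_def_of_pos (by norm_num)]; norm_num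
    _ ≤ _ := by
        rw [← Real.exp_add]
        apply Real.exp_le_exp.mpr
        have := Real.log_pos (show (1:ℝ) < 2 by norm_num)
        nlinarith

lemma total_le (n : ℕ) (hn : 1 ≤ n) :
    (n.factorial : ℝ) * (((n.choose (n/1000) : ℝ) * (2*n)^(n/1000) / (n/1000).factorial) *
      (n.factorial * n * Real.exp 1 * Real.exp (n * (Real.log 2 - 1))) * ((1.01:ℝ)^(2*n) * (n:ℝ)^4848)
        * (n * Hf n 1 0)) ≤ Real.exp 2 * ((n:ℝ)^4852 * Real.exp (-(0.02 * n))) := by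
  have hn' : (1:ℝ) ≤ n := by exact_mod_cast hn
  have hf := fact_exp_le n hn
  have hc := choose_part n hn
  have h101 : (1.01:ℝ)^(2*n) ≤ Real.exp (0.02 * n) := by
    have : (1.01:ℝ) ≤ Real.exp 0.01 := by have := Real.add_one_le_exp (0.01:ℝ); linarith
    calc (1.01:ℝ)^(2*n) ≤ (Real.exp 0.01)^(2*n) := by gcongr
      _ = _ := by rw [← Real.exp_nat_mul]; congr 1; push_cast; ring
  have hHf : (n.factorial : ℝ) * Hf n 1 0 = n * (Real.exp (n * (1 - Real.log n)) * Real.exp ((n-1)/4)) := by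
    have h1 : (n.factorial : ℝ) = n * (n-1).factorial := by
      exact_mod_cast (Nat.mul_factorial_pred (by omega)).symm
    have h2 : ((n-1).factorial : ℝ) ≠ 0 := by positivity
    rw [h1, Hf, ← Real.exp_add]
    simp
    field_simp
  have hx : Real.exp ((n-1)/4) ≤ Real.exp (n/4) := Real.exp_le_exp.mpr (by linarith)
  calc _ = ((n.choose (n/1000) : ℝ) * (2*n)^(n/1000) / (n/1000).factorial) *
      (n.factorial * n * Real.exp 1 * Real.exp (n * (Real.log 2 - 1))) * ((1.01:ℝ)^(2*n) * (n:ℝ)^4848)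
        * (n * (n.factorial * Hf n 1 0)) := by ring
    _ = ((n.choose (n/1000) : ℝ) * (2*n)^(n/1000) / (n/1000).factorial) * (n * Real.exp 1 * Real.exp (n * (Real.log 2 - 1))) * ((1.01:ℝ)^(2*n) * (n:ℝ)^4848)
        * (n * n * ((n.factorial * Real.exp (n * (1 - Real.log n))) * Real.exp ((n-1)/4))) := by rw [hHf]; ring
    _ ≤ Real.exp (n * (0.021 * Real.log 2 + 0.002)) * (n * Real.exp 1 * Real.exp (n * (Real.log 2 - 1))) * (Real.exp (0.02 * n) * (n:ℝ)^4848)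
        * (n * n * ((Real.exp 1 * n) * Real.exp (n/4))) := by gcongr
    _ = Real.exp 2 * ((n:ℝ)^4852 * Real.exp (n * (0.021 * Real.log 2 + 0.002) + n * (Real.log 2 - 1) + 0.02 * n + n/4)) := by
        rw [Real.exp_add, Real.exp_add, Real.exp_add, show (2:ℝ) = 1 + 1 by norm_num, Real.exp_add 1 1]
        norm_num
        ring
    _ ≤ _ := by
        gcongr
        have := Real.log_two_lt_d9
        nlinarith

lemma total_tendsto : Filter.Tendsto (fun n : ℕ => Real.exp 2 * ((n:ℝ)^4852 * Real.exp (-(0.02 * n)))) Filter.atTop (nhds 0) := by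
  have h := (tendsto_rpow_mul_exp_neg_mul_atTop_nhds_zero 4852 0.02 (by norm_num)).comp tendsto_natCast_atTop_atTop
  have h2 := h.const_mul (Real.exp 2)
  rw [mul_zero] at h2
  refine h2.congr fun n => ?_
  simp only [Function.comp_apply]
  congr 2
  · exact_mod_cast Real.rpow_natCast (n:ℝ) 4852
  · congr 1; ring

end LT

/-- there is `η > 0` such that w.h.p. every spanning tree `S` of `K_{A,B}`
containing a perfect matching `M_π` (with `π` a derangement) and admitting dual variables
`u, v` with `u_i + v_j = C(i,j)` on tree edges and `u_i + v_j ≤ C(i,j)` off the diagonal,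
has a contraction `φ(S)` with at least `ηn` leaves. -/
theorem statement_13 :
    ∃ η : ℝ, 0 < η ∧
      Filter.Tendsto
        (fun n : ℕ => costMeasure n
          {C | ∀ (S : Finset (Fin n × Fin n)) (π : Equiv.Perm (Fin n)),
            (bipGraph S).IsTree → (∀ i, π i ≠ i) → (∀ i, (i, π i) ∈ S) →
            (∃ u v : Fin n → ℝ,
              (∀ p ∈ S, C p = u (p : Fin n × Fin n).1 + v (p : Fin n × Fin n).2) ∧
              ∀ i j : Fin n, i ≠ j → u i + v j ≤ C (i, j)) →
            η * n ≤ ({i : Fin n | ((contractGraph π S).neighborSet i).ncard = 1}.ncard : ℝ)})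
        Filter.atTop (nhds 1) := by
  refine ⟨1/1000, by norm_num, ?_⟩
  have hprob : ∀ n, IsProbabilityMeasure (costMeasure n) := by
    intro n
    have : IsProbabilityMeasure (volume.restrict (Set.Icc (0:ℝ) 1)) := ⟨by simp⟩
    unfold costMeasure
    infer_instance
  have hlow : Filter.Tendsto (fun n : ℕ => 1 - ENNReal.ofReal (Real.exp 2 * ((n:ℝ)^4852 * Real.exp (-(0.02 * n)))))
      Filter.atTop (nhds 1) := by
    have h1 := ENNReal.tendsto_ofReal LT.total_tendsto
    have h2 := ENNReal.Tendsto.sub (tendsto_const_nhds (x := (1:ENNReal)) (f := Filter.atTop)) h1 (Or.inl (by simp))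
    simpa using h2
  refine tendsto_of_tendsto_of_tendsto_of_le_of_le' hlow tendsto_const_nhds ?_ ?_
  · filter_upwards [Filter.eventually_ge_atTop 1] with n hn
    have := hprob n
    set Good := {C : Fin n × Fin n → ℝ | _} with hGood
    have hb := (LT.union_bound hn (n/1000) (Nat.div_le_self _ _) Goodᶜ ?_).trans
      (ENNReal.ofReal_le_ofReal (LT.total_le n hn))
    · have h1 : (1:ENNReal) ≤ costMeasure n Good + costMeasure n Goodᶜ := by
        rw [← measure_univ (μ := costMeasure n), ← Set.union_compl_self Good]
        exact measure_union_le _ _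
      rw [tsub_le_iff_right]
      exact h1.trans (by gcongr)
    · intro C hC hc
      rw [hGood, Set.mem_compl_iff, Set.mem_ofPred_eq] at hC
      push Not at hC
      obtain ⟨S, π, hT, hder, hM, ⟨u, v, h1, h2⟩, hlt⟩ := hC
      obtain ⟨e, he, hS, hE⟩ := LT.cover (n/1000) C hc S π hT hM u v h1 h2 (by
        rw [Nat.le_div_iff_mul_le (by norm_num)]
        have : (({i | ((contractGraph π S).neighborSet i).ncard = 1}.ncard * 1000 : ℕ) : ℝ) ≤ n := by
          push_cast; linarith
        exact_mod_cast this)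
      exact ⟨π, e, S, he, hS, hE⟩
  · filter_upwards with n
    have := hprob n
    exact prob_le_one
end

section
/- Let ε > 0 be a sufficiently small constant and set ζ = ⌈n^ε⌉ and γ_ε = 30ζ/(εn). With probability tending to 1 as n → ∞ (over the random cost matrix C), every vertex of K_{A,B} is incident to at most 2n^{2ε} edges of cost at most γ_ε. -/
open MeasureTheory Finset

lemma lintegral_tilt_le (γ : ℝ) (hγ : 0 ≤ γ) :
    ∫⁻ x, (if x ≤ γ then (3 : ENNReal) else 1) ∂(volume.restrict (Set.Icc (0:ℝ) 1)) ≤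
      ENNReal.ofReal (Real.exp (2 * γ)) := by
  have h1 : ∀ x : ℝ, (if x ≤ γ then (3 : ENNReal) else 1) =
      1 + (Set.Iic γ).indicator (fun _ => (2 : ENNReal)) x := by
    intro x
    by_cases hx : x ≤ γ
    · simp [hx]; norm_num
    · simp [hx]
  simp_rw [h1]
  rw [lintegral_add_left measurable_const, lintegral_indicator_const measurableSet_Iic]
  have h2 : (volume.restrict (Set.Icc (0:ℝ) 1)) (Set.Iic γ) ≤ ENNReal.ofReal γ := by
    rw [Measure.restrict_apply measurableSet_Iic]
    calc volume (Set.Iic γ ∩ Set.Icc (0:ℝ) 1) ≤ volume (Set.Icc (0:ℝ) γ) := by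
          apply measure_mono
          rintro x ⟨hx, hx'⟩
          exact ⟨hx'.1, hx⟩
      _ = ENNReal.ofReal γ := by simp
  calc _ ≤ 1 + 2 * ENNReal.ofReal γ := by
        gcongr
        simp
    _ = ENNReal.ofReal (1 + 2 * γ) := by
        rw [ENNReal.ofReal_add (by norm_num) (by positivity), ENNReal.ofReal_mul (by norm_num)]
        simp
    _ ≤ _ := by
        apply ENNReal.ofReal_le_ofReal
        linarith [Real.add_one_le_exp (2 * γ)]

lemma tail_bound {ι : Type} [Fintype ι] (n : ℕ) (e : Fin n → ι) (he : Function.Injective e)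
    (γ t : ℝ) (hγ : 0 ≤ γ) :
    (Measure.pi fun _ : ι => volume.restrict (Set.Icc (0:ℝ) 1))
      {C | t < ({j : Fin n | C (e j) ≤ γ}.ncard : ℝ)} ≤
      ENNReal.ofReal (Real.exp (2 * n * γ - t)) := by
  have : IsProbabilityMeasure (volume.restrict (Set.Icc (0:ℝ) 1)) := ⟨by simp⟩
  set μ : Measure (ι → ℝ) := Measure.pi fun _ : ι => volume.restrict (Set.Icc (0:ℝ) 1) with hμ
  let F : ℝ → ENNReal := fun x => if x ≤ γ then 3 else 1
  have hF : Measurable F := Measurable.ite measurableSet_Iic measurable_const measurable_const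
  have hind : ProbabilityTheory.iIndepFun (fun (i : ι) (C : ι → ℝ) => F (C i)) μ :=
    ProbabilityTheory.iIndepFun_pi (X := fun _ => F) (fun _ => hF.aemeasurable)
  have hind' := hind.precomp he
  have hint : ∫⁻ C, ∏ j : Fin n, F (C (e j)) ∂μ ≤ ENNReal.ofReal (Real.exp (2 * n * γ)) := by
    have := ProbabilityTheory.lintegral_prod_eq_prod_lintegral_of_indepFun Finset.univ
      (fun (j : Fin n) (C : ι → ℝ) => F (C (e j))) hind'
      (fun j => hF.comp (measurable_pi_apply _))
    rw [this]
    have h1 : ∀ j : Fin n, ∫⁻ C, F (C (e j)) ∂μ ≤ ENNReal.ofReal (Real.exp (2 * γ)) := by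
      intro j
      have hmp : MeasurePreserving (Function.eval (e j)) μ (volume.restrict (Set.Icc (0:ℝ) 1)) :=
        measurePreserving_eval (fun _ : ι => volume.restrict (Set.Icc (0:ℝ) 1)) (e j)
      have := hmp.lintegral_comp hF
      simp only [Function.eval] at this
      rw [this]
      exact lintegral_tilt_le γ hγ
    calc _ ≤ ∏ _j : Fin n, ENNReal.ofReal (Real.exp (2 * γ)) :=
          Finset.prod_le_prod' (fun j _ => h1 j)
      _ = _ := by
          rw [Finset.prod_const, ← ENNReal.ofReal_pow (Real.exp_pos _).le, ← Real.exp_nat_mul]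
          simp
          ring_nf
  have hsub : {C : ι → ℝ | t < ({j : Fin n | C (e j) ≤ γ}.ncard : ℝ)} ⊆
      {C | ENNReal.ofReal (Real.exp t) ≤ ∏ j : Fin n, F (C (e j))} := by
    intro C hC
    simp only [Set.mem_ofPred_eq] at hC ⊢
    have hcard : {j : Fin n | C (e j) ≤ γ}.ncard =
        (Finset.univ.filter (fun j : Fin n => C (e j) ≤ γ)).card := by
      rw [← Set.ncard_coe_finset]; simp
    have hp : ∏ j : Fin n, F (C (e j)) =
        3 ^ (Finset.univ.filter (fun j : Fin n => C (e j) ≤ γ)).card := by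
      simp only [F]
      rw [Finset.prod_ite]; simp
    rw [hp, ← hcard]
    have h3 : (3 : ENNReal) = ENNReal.ofReal 3 := by simp
    rw [h3, ← ENNReal.ofReal_pow (by norm_num)]
    apply ENNReal.ofReal_le_ofReal
    calc Real.exp t ≤ Real.exp ({j : Fin n | C (e j) ≤ γ}.ncard : ℝ) := Real.exp_le_exp.2 hC.le
      _ = Real.exp 1 ^ {j : Fin n | C (e j) ≤ γ}.ncard := by rw [← Real.exp_nat_mul]; simp
      _ ≤ _ := by
        gcongr
        linarith [Real.exp_one_lt_d9]
  have hmeas : Measurable (fun C : ι → ℝ => ∏ j : Fin n, F (C (e j))) :=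
    Finset.measurable_prod _ (fun j _ => hF.comp (measurable_pi_apply _))
  have hmk := mul_meas_ge_le_lintegral (μ := μ) hmeas (ENNReal.ofReal (Real.exp t))
  refine (measure_mono hsub).trans ?_
  rw [Real.exp_sub, ENNReal.ofReal_div_of_pos (Real.exp_pos _)]
  rw [ENNReal.le_div_iff_mul_le (Or.inl (by simp [Real.exp_pos])) (Or.inl (by simp)), mul_comm]
  exact hmk.trans hint

lemma asymp_bound (ε : ℝ) (hε : 0 < ε) :
    Filter.Tendsto (fun n : ℕ => 2 * (n : ℝ) *
      Real.exp (2 * n * (30 * (⌈(n : ℝ) ^ ε⌉₊ : ℝ) / (ε * n)) - 2 * (n : ℝ) ^ (2 * ε)))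
      Filter.atTop (nhds 0) := by
  have hy : Filter.Tendsto (fun n : ℕ => (n : ℝ) ^ ε) Filter.atTop Filter.atTop :=
    (tendsto_rpow_atTop hε).comp tendsto_natCast_atTop_atTop
  have hlim : Filter.Tendsto (fun n : ℕ => 2 * (((n : ℝ) ^ ε) ^ (1 / ε) *
      Real.exp (-1 * (n : ℝ) ^ ε))) Filter.atTop (nhds 0) := by
    have := ((tendsto_rpow_mul_exp_neg_mul_atTop_nhds_zero (1 / ε) 1 one_pos).comp hy).const_mul 2
    simpa using this
  refine squeeze_zero' (Filter.Eventually.of_forall fun n => by positivity) ?_ hlim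
  filter_upwards [hy.eventually_ge_atTop (120 / ε + 1), Filter.eventually_ge_atTop 1] with n hn hn1
  have hn0 : (0:ℝ) < n := by exact_mod_cast hn1
  have hK : 0 < 60 / ε := by positivity
  have h120 : 120 / ε = 2 * (60 / ε) := by ring
  rw [h120] at hn
  rw [← Real.rpow_mul hn0.le, mul_one_div_cancel hε.ne', Real.rpow_one, mul_assoc]
  have hsq : (n : ℝ) ^ (2 * ε) = ((n : ℝ) ^ ε) ^ 2 := by
    rw [mul_comm, Real.rpow_mul hn0.le]; norm_num
  have hceil : (⌈(n : ℝ) ^ ε⌉₊ : ℝ) ≤ (n : ℝ) ^ ε + 1 :=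
    (Nat.ceil_lt_add_one (by positivity)).le
  have heq : 2 * (n : ℝ) * (30 * (⌈(n : ℝ) ^ ε⌉₊ : ℝ) / (ε * n)) =
      (60 / ε) * (⌈(n : ℝ) ^ ε⌉₊ : ℝ) := by
    field_simp
    norm_num
  gcongr
  rw [heq, hsq]
  generalize (n : ℝ) ^ ε = y at *
  generalize 60 / ε = K at *
  nlinarith [mul_le_mul_of_nonneg_left hceil hK.le]

/-- for sufficiently small `ε > 0`, w.h.p. every vertex of `K_{A,B}` is
incident to at most `2n^{2ε}` edges of cost at most `γ_ε = 30ζ/(εn)`, `ζ = ⌈n^ε⌉`. -/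
theorem statement_15 :
    ∃ ε₀ : ℝ, 0 < ε₀ ∧ ∀ ε : ℝ, 0 < ε → ε ≤ ε₀ →
      Filter.Tendsto
        (fun n : ℕ => costMeasure n
          {C | (∀ i : Fin n,
                  ({j : Fin n | C (i, j) ≤ 30 * (⌈(n : ℝ) ^ ε⌉₊ : ℝ) / (ε * n)}.ncard : ℝ) ≤
                    2 * (n : ℝ) ^ (2 * ε)) ∧
               (∀ j : Fin n,
                  ({i : Fin n | C (i, j) ≤ 30 * (⌈(n : ℝ) ^ ε⌉₊ : ℝ) / (ε * n)}.ncard : ℝ) ≤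
                    2 * (n : ℝ) ^ (2 * ε))})
        Filter.atTop (nhds 1) := by
  refine ⟨1, one_pos, fun ε hε _ => ?_⟩
  have hb := ENNReal.tendsto_ofReal (asymp_bound ε hε)
  rw [ENNReal.ofReal_zero] at hb
  have hb1 := ENNReal.Tendsto.sub (tendsto_const_nhds (x := (1 : ENNReal)) (f := Filter.atTop))
    hb (Or.inl ENNReal.one_ne_top)
  rw [tsub_zero] at hb1
  have : IsProbabilityMeasure (volume.restrict (Set.Icc (0:ℝ) 1)) := ⟨by simp⟩
  have hprob : ∀ n, IsProbabilityMeasure (costMeasure n) := fun n => by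
    unfold costMeasure; infer_instance
  refine tendsto_of_tendsto_of_tendsto_of_le_of_le hb1 tendsto_const_nhds ?_
    (fun n => by have := hprob n; exact prob_le_one)
  intro n
  have := hprob n
  dsimp only
  set γ : ℝ := 30 * (⌈(n : ℝ) ^ ε⌉₊ : ℝ) / (ε * n) with hγdef
  have hγ : 0 ≤ γ := by positivity
  set t : ℝ := 2 * (n : ℝ) ^ (2 * ε) with ht
  set S : Set (Fin n × Fin n → ℝ) := {C | (∀ i : Fin n,
    ({j : Fin n | C (i, j) ≤ γ}.ncard : ℝ) ≤ t) ∧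
    (∀ j : Fin n, ({i : Fin n | C (i, j) ≤ γ}.ncard : ℝ) ≤ t)} with hS
  have hcompl : Sᶜ ⊆ (⋃ i : Fin n, {C | t < ({j : Fin n | C (i, j) ≤ γ}.ncard : ℝ)}) ∪
      (⋃ j : Fin n, {C | t < ({i : Fin n | C (i, j) ≤ γ}.ncard : ℝ)}) := by
    intro C hC
    by_contra hcon
    simp only [Set.mem_union, Set.mem_iUnion, Set.mem_ofPred_eq, not_or, not_exists, not_lt] at hcon
    exact hC hcon
  have hrow : ∀ i : Fin n, costMeasure n {C | t < ({j : Fin n | C (i, j) ≤ γ}.ncard : ℝ)} ≤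
      ENNReal.ofReal (Real.exp (2 * n * γ - t)) := fun i =>
    tail_bound n (fun j => (i, j)) (fun a b h => (Prod.ext_iff.1 h).2) γ t hγ
  have hcol : ∀ j : Fin n, costMeasure n {C | t < ({i : Fin n | C (i, j) ≤ γ}.ncard : ℝ)} ≤
      ENNReal.ofReal (Real.exp (2 * n * γ - t)) := fun j =>
    tail_bound n (fun i => (i, j)) (fun a b h => (Prod.ext_iff.1 h).1) γ t hγ
  have hbad : costMeasure n Sᶜ ≤ ENNReal.ofReal (2 * (n : ℝ) * Real.exp (2 * n * γ - t)) := by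
    calc costMeasure n Sᶜ ≤ _ := measure_mono hcompl
      _ ≤ _ := measure_union_le _ _
      _ ≤ (∑ _i : Fin n, ENNReal.ofReal (Real.exp (2 * n * γ - t))) +
          (∑ _i : Fin n, ENNReal.ofReal (Real.exp (2 * n * γ - t))) := by
        refine add_le_add ?_ ?_
        · exact (measure_iUnion_fintype_le _ _).trans (Finset.sum_le_sum fun i _ => hrow i)
        · exact (measure_iUnion_fintype_le _ _).trans (Finset.sum_le_sum fun i _ => hcol i)
      _ = _ := by
        rw [mul_assoc, ENNReal.ofReal_mul (by norm_num), ENNReal.ofReal_mul (by positivity)]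
        simp [two_mul, add_mul]
  have h1 : (1 : ENNReal) ≤ costMeasure n S + costMeasure n Sᶜ := by
    rw [← measure_univ (μ := costMeasure n), ← Set.union_compl_self S]
    exact measure_union_le _ _
  rw [tsub_le_iff_right]
  exact h1.trans (by gcongr)
end
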